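/- For every w > 0 there exists a constant C > 0 with the following property: for every complete connected translating graph Σ contained in the slab {(x,y,z) : |x| ≤ w} and every closed axis-parallel cube Q ⊆ ℝ³ of side length w, the Euclidean area satisfies ℋ²(Q ∩ Σ) ≤ C. In particular C is independent of the cube Q and of the graph Σ. -/

import Mathlib

open MeasureTheory Metric Real EuclideanSpace
open scoped RealInnerProductSpace ENNReal NNReal

noncomputable section

abbrev E3 : Type := EuclideanSpace ℝ (Fin 3)

def e1 : E3 := EuclideanSpace.single 0 1
def e2 : E3 := EuclideanSpace.single 1 1
def e3 : E3 := EuclideanSpace.single 2 1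

/-- First partial derivative of `u` in the first variable. -/
def pds (u : ℝ × ℝ → ℝ) (p : ℝ × ℝ) : ℝ := fderiv ℝ u p (1, 0)

/-- First partial derivative of `u` in the second variable. -/
def pdt (u : ℝ × ℝ → ℝ) (p : ℝ × ℝ) : ℝ := fderiv ℝ u p (0, 1)

/-- `S` is a translating graph in the direction of the unit vector `v`, with respect to the
orthonormal basis `(a, b, v)` of `ℝ³`, over the open connected domain `Ω ⊆ ℝ²`, given by the
smooth function `u : Ω → ℝ` solving the translator equation. -/
structure IsTranslatingGraph (a b v : E3) (Ω : Set (ℝ × ℝ)) (u : ℝ × ℝ → ℝ)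
    (S : Set E3) : Prop where
  norm_a : ‖a‖ = 1
  norm_b : ‖b‖ = 1
  norm_v : ‖v‖ = 1
  inner_ab : ⟪a, b⟫ = 0
  inner_av : ⟪a, v⟫ = 0
  inner_bv : ⟪b, v⟫ = 0
  isOpen_dom : IsOpen Ω
  isConnected_dom : IsConnected Ω
  smooth : ContDiffOn ℝ (⊤ : ℕ∞) u Ω
  pde : ∀ p ∈ Ω,
    (1 + (pdt u p) ^ 2) * pds (fun q => pds u q) p
      - 2 * pds u p * pdt u p * pdt (fun q => pds u q) p
      + (1 + (pds u p) ^ 2) * pdt (fun q => pdt u q) p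
    = (1 + (pds u p) ^ 2 + (pdt u p) ^ 2) *
        (⟪e3, v⟫ - pds u p * ⟪e3, a⟫ - pdt u p * ⟪e3, b⟫)
  graph_eq : S = {q : E3 | ∃ p ∈ Ω, q = p.1 • a + p.2 • b + u p • v}

/-- Entropy of a surface. -/
def entropy (S : Set E3) : ℝ≥0∞ :=
  ⨆ (x₀ : E3) (s₀ : ℝ) (_ : 0 < s₀),
    (ENNReal.ofReal (4 * π * s₀))⁻¹ *
      ∫⁻ q in S, ENNReal.ofReal (Real.exp (-‖q - x₀‖ ^ 2 / (4 * s₀))) ∂(μH[2])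

/-- Number of connected components (as a cardinal). -/
def numComponents (A : Set E3) : Cardinal := Cardinal.mk (ConnectedComponents A)

def vθ (θ : ℝ) : E3 := Real.sin θ • e3 + Real.cos θ • e2
def bθ (θ : ℝ) : E3 := Real.cos θ • e3 - Real.sin θ • e2


/-- The point of the translating graph over parameter `p`, for the basis `(e₁, b_θ, v_θ)`. -/
def graphPtθ (θ : ℝ) (u : ℝ × ℝ → ℝ) (p : ℝ × ℝ) : E3 :=
  p.1 • e1 + p.2 • bθ θ + u p • vθ θ

/-- The Gauss map of a translating graph in the direction `v_θ`, as a function of the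
parameter `p ∈ Ω`: `N = (v_θ − u_s e₁ − u_t b_θ)/√(1+u_s²+u_t²)`. -/
def gaussMapθ (θ : ℝ) (u : ℝ × ℝ → ℝ) (p : ℝ × ℝ) : E3 :=
  (Real.sqrt (1 + (pds u p) ^ 2 + (pdt u p) ^ 2))⁻¹ •
    (vθ θ - pds u p • e1 - pdt u p • bθ θ)

/-- Translator data over a planar domain, in coordinates for which the velocity has components
`(0, c, s)` in the basis of the graph, together with closedness of the graph. -/
structure PlanarTranslator (c s : ℝ) (Ω : Set (ℝ × ℝ)) (u : ℝ × ℝ → ℝ) : Prop where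
  abs_c : |c| ≤ 1
  abs_s : |s| ≤ 1
  isOpen : IsOpen Ω
  isPreconnected : IsPreconnected Ω
  smooth : ContDiffOn ℝ (⊤ : ℕ∞) u Ω
  pde : ∀ p ∈ Ω,
    (1 + (pdt u p) ^ 2) * pds (fun q => pds u q) p
      - 2 * pds u p * pdt u p * pdt (fun q => pds u q) p
      + (1 + (pds u p) ^ 2) * pdt (fun q => pdt u q) p
    = (1 + (pds u p) ^ 2 + (pdt u p) ^ 2) * (s - pdt u p * c)
  closed : IsClosed {x : (ℝ × ℝ) × ℝ | x.1 ∈ Ω ∧ x.2 = u x.1}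

section Calculus

variable {Ω : Set (ℝ × ℝ)} {u : ℝ × ℝ → ℝ} {p : ℝ × ℝ}

lemma fderiv_apply_eq_partials (u : ℝ × ℝ → ℝ) (p ξ : ℝ × ℝ) :
    fderiv ℝ u p ξ = ξ.1 * pds u p + ξ.2 * pdt u p := by
  have : ξ = ξ.1 • ((1 : ℝ), (0 : ℝ)) + ξ.2 • ((0 : ℝ), (1 : ℝ)) := by
    ext <;> simp
  conv_lhs => rw [this]
  rw [map_add, map_smul, map_smul]
  simp [pds, pdt]

lemma contDiffOn_pds (hΩ : IsOpen Ω) (hu : ContDiffOn ℝ (⊤ : ℕ∞) u Ω) :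
    ContDiffOn ℝ (⊤ : ℕ∞) (pds u) Ω :=
  (hu.fderiv_of_isOpen hΩ (by simp)).clm_apply contDiffOn_const

lemma contDiffOn_pdt (hΩ : IsOpen Ω) (hu : ContDiffOn ℝ (⊤ : ℕ∞) u Ω) :
    ContDiffOn ℝ (⊤ : ℕ∞) (pdt u) Ω :=
  (hu.fderiv_of_isOpen hΩ (by simp)).clm_apply contDiffOn_const

lemma differentiableAt_of_smooth (hΩ : IsOpen Ω) (hu : ContDiffOn ℝ (⊤ : ℕ∞) u Ω) (hp : p ∈ Ω) :
    DifferentiableAt ℝ u p :=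
  (hu.contDiffAt (hΩ.mem_nhds hp)).differentiableAt (by simp)

lemma pds_pdt_comm (hΩ : IsOpen Ω) (hu : ContDiffOn ℝ (⊤ : ℕ∞) u Ω) (hp : p ∈ Ω) :
    pds (pdt u) p = pdt (pds u) p := by
  have h := (hu.contDiffAt (hΩ.mem_nhds hp)).isSymmSndFDerivAt
    (by simpa using (mod_cast le_top : ((2 : ℕ∞) : WithTop ℕ∞) ≤ ((⊤ : ℕ∞) : WithTop ℕ∞)))
  have hd : DifferentiableAt ℝ (fderiv ℝ u) p :=
    ((hu.fderiv_of_isOpen hΩ (m := (⊤ : ℕ∞)) (by simp)).contDiffAt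
      (hΩ.mem_nhds hp)).differentiableAt (by simp)
  have e1 : pds (pdt u) p = fderiv ℝ (fderiv ℝ u) p (1, 0) (0, 1) := by
    change fderiv ℝ (fun q => fderiv ℝ u q (0, 1)) p (1, 0) = _
    rw [fderiv_clm_apply hd (differentiableAt_const _)]
    simp
  have e2 : pdt (pds u) p = fderiv ℝ (fderiv ℝ u) p (0, 1) (1, 0) := by
    change fderiv ℝ (fun q => fderiv ℝ u q (1, 0)) p (0, 1) = _
    rw [fderiv_clm_apply hd (differentiableAt_const _)]
    simp
  rw [e1, e2]
  exact h _ _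

lemma hasDerivAt_line (h : DifferentiableAt ℝ u (p : ℝ × ℝ)) (q ξ : ℝ × ℝ) (τ : ℝ)
    (hp : p = q + τ • ξ) :
    HasDerivAt (fun r : ℝ => u (q + r • ξ)) (ξ.1 * pds u p + ξ.2 * pdt u p) τ := by
  subst hp
  have h1 : HasDerivAt (fun r : ℝ => q + r • ξ) ξ τ := by
    simpa using ((hasDerivAt_id τ).smul_const ξ).const_add q
  have := h.hasFDerivAt.comp_hasDerivAt τ h1
  rwa [fderiv_apply_eq_partials] at this

/-- Necessary second-order condition at a local minimum on the line. -/
lemma IsLocalMin.second_deriv_nonneg {φ φ' : ℝ → ℝ} {d x : ℝ} (hmin : IsLocalMin φ x)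
    (h1 : ∀ᶠ y in nhds x, HasDerivAt φ (φ' y) y) (h2 : HasDerivAt φ' d x) : 0 ≤ d := by
  by_contra! hd
  have hde : deriv φ =ᶠ[nhds x] φ' := h1.mono fun y hy => hy.deriv
  have h0 : deriv φ x = 0 := hmin.deriv_eq_zero
  have h3 : deriv (deriv φ) x = d := by rw [hde.deriv_eq]; exact h2.deriv
  have hmax := isLocalMax_of_deriv_deriv_neg (by rw [h3]; exact hd) h0 h1.self_of_nhds.continuousAt
  have hc : φ =ᶠ[nhds x] fun _ => φ x := by
    filter_upwards [hmin, hmax] with y a b using le_antisymm b a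
  have h4 : deriv φ =ᶠ[nhds x] deriv (fun _ => φ x) := hc.deriv
  have h5 : deriv (deriv φ) x = 0 := by rw [h4.deriv_eq]; simp
  linarith

end Calculus

section Barrier

variable {Ω B : Set (ℝ × ℝ)} {u : ℝ × ℝ → ℝ} {p : ℝ × ℝ} {f f' f'' g g' g'' : ℝ → ℝ} {c s : ℝ}

/-- First and second order conditions along a line at an interior minimum of
`f x + g t + a (u - m)²`. -/
lemma barrier_line_conditions (hΩ : IsOpen Ω) (hu : ContDiffOn ℝ (⊤ : ℕ∞) u Ω) (hp : p ∈ Ω)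
    (hB : B ∈ nhds p)
    (hf : ∀ q ∈ B, HasDerivAt f (f' q.1) q.1 ∧ HasDerivAt f' (f'' q.1) q.1)
    (hg : ∀ q ∈ B, HasDerivAt g (g' q.2) q.2 ∧ HasDerivAt g' (g'' q.2) q.2) (a m : ℝ)
    (hmin : IsLocalMin (fun q : ℝ × ℝ => f q.1 + g q.2 + a * (u q - m) ^ 2) p) (ξ : ℝ × ℝ) :
    f' p.1 * ξ.1 + g' p.2 * ξ.2 + 2 * a * (u p - m) * (ξ.1 * pds u p + ξ.2 * pdt u p) = 0 ∧
    0 ≤ f'' p.1 * ξ.1 ^ 2 + g'' p.2 * ξ.2 ^ 2 + 2 * a * ((ξ.1 * pds u p + ξ.2 * pdt u p) ^ 2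
      + (u p - m) * (ξ.1 ^ 2 * pds (pds u) p + 2 * ξ.1 * ξ.2 * pdt (pds u) p
        + ξ.2 ^ 2 * pdt (pdt u) p)) := by
  set l : ℝ → ℝ × ℝ := fun r => p + r • ξ with hl
  have hlc : Continuous l := by fun_prop
  have hl0 : l 0 = p := by simp [hl]
  have hl1 : ∀ r, HasDerivAt (fun r => (l r).1) ξ.1 r := fun r => by
    simpa [hl] using ((hasDerivAt_id r).mul_const ξ.1).const_add p.1
  have hl2 : ∀ r, HasDerivAt (fun r => (l r).2) ξ.2 r := fun r => by
    simpa [hl] using ((hasDerivAt_id r).mul_const ξ.2).const_add p.2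
  have hmin' : IsLocalMin (fun r => f (l r).1 + g (l r).2 + a * (u (l r) - m) ^ 2) 0 := by
    have : Filter.Tendsto l (nhds 0) (nhds p) := by
      have := hlc.tendsto 0; rwa [hl0] at this
    have h2 := this.eventually hmin
    filter_upwards [h2] with r hr
    simpa only [hl0] using hr
  have hev : ∀ᶠ r in nhds (0 : ℝ), l r ∈ B ∧ l r ∈ Ω := by
    have : Filter.Tendsto l (nhds 0) (nhds p) := by
      have := hlc.tendsto 0; rwa [hl0] at this
    exact this.eventually (Filter.inter_mem hB (hΩ.mem_nhds hp))
  have hd1 : ∀ᶠ r in nhds (0 : ℝ),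
      HasDerivAt (fun r => f (l r).1 + g (l r).2 + a * (u (l r) - m) ^ 2)
        (f' (l r).1 * ξ.1 + g' (l r).2 * ξ.2
          + 2 * a * ((u (l r) - m) * (ξ.1 * pds u (l r) + ξ.2 * pdt u (l r)))) r := by
    filter_upwards [hev] with r hr
    have h1 := (hf _ hr.1).1.comp r (hl1 r)
    have h2 := (hg _ hr.1).1.comp r (hl2 r)
    have h3 := hasDerivAt_line (differentiableAt_of_smooth hΩ hu hr.2) p ξ r rfl
    have h4 := ((h3.sub_const m).pow 2).const_mul a
    refine ((h1.add h2).add h4).congr_deriv ?_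
    simp [hl]; ring
  have hd2 : HasDerivAt (fun r => f' (l r).1 * ξ.1 + g' (l r).2 * ξ.2
          + 2 * a * ((u (l r) - m) * (ξ.1 * pds u (l r) + ξ.2 * pdt u (l r))))
      (f'' p.1 * ξ.1 ^ 2 + g'' p.2 * ξ.2 ^ 2 + 2 * a * ((ξ.1 * pds u p + ξ.2 * pdt u p) ^ 2
      + (u p - m) * (ξ.1 ^ 2 * pds (pds u) p + 2 * ξ.1 * ξ.2 * pdt (pds u) p
        + ξ.2 ^ 2 * pdt (pdt u) p))) 0 := by
    have hr := hev.self_of_nhds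
    have h1 := ((hf _ hr.1).2.comp (0 : ℝ) (hl1 0)).mul_const ξ.1
    have h2 := ((hg _ hr.1).2.comp (0 : ℝ) (hl2 0)).mul_const ξ.2
    have h3 := hasDerivAt_line (differentiableAt_of_smooth hΩ hu hr.2) p ξ 0 rfl
    have h4 := hasDerivAt_line
      (differentiableAt_of_smooth hΩ (contDiffOn_pds hΩ hu) hr.2) p ξ 0 rfl
    have h5 := hasDerivAt_line
      (differentiableAt_of_smooth hΩ (contDiffOn_pdt hΩ hu) hr.2) p ξ 0 rfl
    have h6 := ((h3.sub_const m).mul ((h4.const_mul ξ.1).add (h5.const_mul ξ.2))).const_mul (2 * a)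
    refine ((h1.add h2).add h6).congr_deriv ?_
    rw [hl0, pds_pdt_comm hΩ hu hp]
    simp only [Pi.add_apply, zero_smul, add_zero]
    ring
  refine ⟨?_, hmin'.second_deriv_nonneg hd1 hd2⟩
  have := hmin'.hasDerivAt_eq_zero hd1.self_of_nhds
  rw [hl0] at this
  linarith

/-- The numerical contradiction behind the barrier principle. -/
lemma barrier_arithmetic {A T θ δ K a y us ut uss ust utt F1 G1 F2 G2 : ℝ} (hA1 : 1 ≤ A)
    (hTpos : 0 < T) (hθ : 0 < θ) (hδ : 0 < δ) (hT1 : 1 ≤ T) (hT2 : 4 * A / T ≤ θ / 2)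
    (hT3 : K + 1 < θ / 2 * (δ / (4 * A ^ 2)) * T ^ 2) (hT4 : 4 * A / T ≤ 1)
    (ha : a = A / T ^ 2) (hs : |s| ≤ 1) (hpT : |y| ≤ T)
    (k1 : F1 + 2 * a * y * us = 0) (k2 : G1 + 2 * a * y * ut = 0)
    (d1 : 0 ≤ F2 + 2 * a * (us ^ 2 + y * uss)) (d2 : 0 ≤ G2 + 2 * a * (ut ^ 2 + y * utt))
    (d3 : 0 ≤ F2 * ut ^ 2 + G2 * (-us) ^ 2 + 2 * a * ((ut * us + -us * ut) ^ 2
      + y * (ut ^ 2 * uss + 2 * ut * -us * ust + (-us) ^ 2 * utt)))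
    (hpde : (1 + ut ^ 2) * uss - 2 * us * ut * ust + (1 + us ^ 2) * utt
      = (1 + us ^ 2 + ut ^ 2) * (s - ut * c))
    (hgr : δ ≤ F1 ^ 2 + G1 ^ 2) (hla : F2 + G2 + c * G1 ≤ K)
    (hta : F2 * G1 ^ 2 + G2 * F1 ^ 2 + c * G1 * (F1 ^ 2 + G1 ^ 2) ≤ -θ * (F1 ^ 2 + G1 ^ 2)) :
    False := by
  have hapos : 0 < a := by rw [ha]; positivity
  set k := 2 * a * y with hk
  have hF1 : F1 = - k * us := by linarith
  have hG1 : G1 = - k * ut := by linarith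
  set D := us ^ 2 + ut ^ 2 with hD
  have hD0 : 0 ≤ D := by positivity
  have hFD : F1 ^ 2 + G1 ^ 2 = k ^ 2 * D := by rw [hF1, hG1, hD]; ring
  have hk0 : 0 < k ^ 2 := by
    rcases (sq_nonneg k).eq_or_lt with h0 | h0
    · rw [hFD, ← h0] at hgr; linarith
    · exact h0
  have hta' : F2 * ut ^ 2 + G2 * us ^ 2 + c * G1 * D ≤ -θ * D := by
    have : k ^ 2 * (F2 * ut ^ 2 + G2 * us ^ 2 + c * G1 * D) ≤ k ^ 2 * (-θ * D) := by
      rw [hFD] at hta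
      have e1 : F1 ^ 2 = k ^ 2 * us ^ 2 := by rw [hF1]; ring
      have e2 : G1 ^ 2 = k ^ 2 * ut ^ 2 := by rw [hG1]; ring
      rw [e1, e2] at hta
      linarith
    exact le_of_mul_le_mul_left this hk0
  have hsum : 0 ≤ (F2 + G2 + c * G1) + (F2 * ut ^ 2 + G2 * us ^ 2 + c * G1 * D)
      + k * s * (1 + D) + 2 * a * D := by
    have e : k * ((1 + ut ^ 2) * uss - 2 * us * ut * ust + (1 + us ^ 2) * utt)
        = k * ((1 + us ^ 2 + ut ^ 2) * (s - ut * c)) := by rw [hpde]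
    have e' : c * G1 * (1 + D) = - k * ut * c * (1 + D) := by rw [hG1]; ring
    simp only [hk, hD] at e e' ⊢
    refine (add_nonneg (add_nonneg d1 d2) d3).trans (le_of_eq ?_)
    linear_combination e - e'
  have hkT : |k| ≤ 2 * A / T := by
    rw [hk, abs_mul, abs_of_pos (by positivity : 0 < 2 * a), ha]
    have e : 2 * A / T = 2 * (A / T ^ 2) * T := by field_simp
    rw [e]
    gcongr
  have haT2 : 2 * a ≤ 2 * A / T := by
    rw [ha, mul_div_assoc]
    gcongr
    exact le_self_pow₀ hT1 two_ne_zero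
  have hks : k * s ≤ 2 * A / T := by
    have : |k * s| ≤ |k| * 1 := by rw [abs_mul]; gcongr
    linarith [le_abs_self (k * s)]
  have hDbig : δ / (4 * A ^ 2) * T ^ 2 ≤ D := by
    have h1 : k ^ 2 ≤ (2 * A / T) ^ 2 := by rw [← sq_abs k]; gcongr
    have h2 : δ ≤ (2 * A / T) ^ 2 * D := by
      rw [hFD] at hgr; nlinarith
    have h3 : (2 * A / T) ^ 2 = 4 * A ^ 2 / T ^ 2 := by rw [div_pow]; ring
    rw [h3] at h2
    rw [div_mul_eq_mul_div, div_le_iff₀ (by positivity)]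
    rw [div_mul_eq_mul_div, le_div_iff₀ (by positivity)] at h2
    linarith
  have e4 : 4 * A / T = 2 * A / T + 2 * A / T := by ring
  have h5 : θ / 2 * (δ / (4 * A ^ 2)) * T ^ 2 ≤ θ / 2 * D := by
    have := mul_le_mul_of_nonneg_left hDbig (by positivity : 0 ≤ θ / 2)
    linarith
  have h6 : k * s * (1 + D) ≤ 2 * A / T * (1 + D) := by gcongr
  have h7 : 2 * a * D ≤ 2 * A / T * D := by gcongr
  have h8 : 4 * A / T * D ≤ θ / 2 * D := by gcongr
  have h9 : 0 < 2 * A / T := by positivity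
  have h10 : 2 * A / T * D + 2 * A / T * D = 4 * A / T * D := by rw [e4]; ring
  linarith

/-- A strict barrier bounds the height function of a complete translating graph: if the level
sets of `f x + g t` are strictly curved relative to translating cylinders on a compact set `B`,
then `u` is bounded on the part of `B` where `f x + g t < 0` as soon as it is so at the boundary
of `B`. -/
lemma PlanarTranslator.bounded_of_barrier (h : PlanarTranslator c s Ω u) (hBc : IsCompact B)
    (hf : ∀ q ∈ B, HasDerivAt f (f' q.1) q.1 ∧ HasDerivAt f' (f'' q.1) q.1)
    (hg : ∀ q ∈ B, HasDerivAt g (g' q.2) q.2 ∧ HasDerivAt g' (g'' q.2) q.2)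
    {θ K δ M : ℝ} (hθ : 0 < θ) (hδ : 0 < δ)
    (hgrad : ∀ q ∈ B, δ ≤ f' q.1 ^ 2 + g' q.2 ^ 2)
    (hlap : ∀ q ∈ B, f'' q.1 + g'' q.2 + c * g' q.2 ≤ K)
    (htan : ∀ q ∈ B, f'' q.1 * g' q.2 ^ 2 + g'' q.2 * f' q.1 ^ 2
      + c * g' q.2 * (f' q.1 ^ 2 + g' q.2 ^ 2) ≤ - θ * (f' q.1 ^ 2 + g' q.2 ^ 2))
    (hbd : ∀ q ∈ B, q ∈ Ω → f q.1 + g q.2 < 0 → B ∉ nhds q → |u q| ≤ M) :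
    ∃ M', ∀ q ∈ B, q ∈ Ω → f q.1 + g q.2 < 0 → |u q| ≤ M' := by
  have hcont : ContinuousOn (fun q : ℝ × ℝ => f q.1 + g q.2) B := fun q hq =>
    (((hf q hq).1.continuousAt.comp continuousAt_fst).add
      ((hg q hq).1.continuousAt.comp continuousAt_snd)).continuousWithinAt
  obtain ⟨A, hA1, hA⟩ : ∃ A : ℝ, 1 ≤ A ∧ ∀ q ∈ B, -A ≤ f q.1 + g q.2 := by
    obtain ⟨A, hA⟩ := hBc.exists_bound_of_continuousOn hcont
    refine ⟨max A 1, le_max_right _ _, fun q hq => ?_⟩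
    have := abs_le.1 (hA q hq)
    linarith [le_max_left A 1]
  obtain ⟨T, hT0, hT1, hT2, hT3⟩ : ∃ T : ℝ, 1 ≤ T ∧ 4 * A / T ≤ θ / 2 ∧ 4 * A / T ≤ 1 ∧
      K + 1 < θ / 2 * (δ / (4 * A ^ 2)) * T ^ 2 := by
    have t1 : Filter.Tendsto (fun T : ℝ => 4 * A / T) Filter.atTop (nhds 0) :=
      tendsto_const_nhds.div_atTop Filter.tendsto_id
    have hpos : 0 < θ / 2 * (δ / (4 * A ^ 2)) := by positivity
    have t2 : Filter.Tendsto (fun T : ℝ => θ / 2 * (δ / (4 * A ^ 2)) * T ^ 2)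
        Filter.atTop Filter.atTop :=
      (Filter.tendsto_pow_atTop two_ne_zero).const_mul_atTop hpos
    have := (Filter.eventually_ge_atTop (1 : ℝ)).and
      ((t1.eventually_le_const (show 0 < θ / 2 by positivity)).and
      ((t1.eventually_le_const one_pos).and (t2.eventually_gt_atTop (K + 1))))
    exact this.exists
  refine ⟨M + T, fun p₀ hp₀B hp₀ hneg => ?_⟩
  by_contra! hgt
  set m := u p₀ with hm
  set a := A / T ^ 2 with ha
  have hTpos : 0 < T := by linarith
  have hapos : 0 < a := by positivity
  have haT : a * T ^ 2 = A := by rw [ha]; field_simp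
  set S : Set (ℝ × ℝ) := {q | q ∈ B ∧ q ∈ Ω ∧ |u q - m| ≤ T} with hS
  have hSc : IsCompact S := by
    have h1 : IsCompact ({x : (ℝ × ℝ) × ℝ | x.1 ∈ Ω ∧ x.2 = u x.1}
        ∩ B ×ˢ Set.Icc (m - T) (m + T)) :=
      (hBc.prod isCompact_Icc).inter_left h.closed
    have h2 := h1.image continuous_fst
    convert h2 using 1
    ext q
    simp only [hS, Set.mem_ofPred_eq, Set.mem_image, Set.mem_inter_iff, Set.mem_prod, Set.mem_Icc,
      Prod.exists, exists_and_right, exists_eq_right, abs_le]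
    constructor
    · rintro ⟨h1, h2, h3, h4⟩
      exact ⟨u q, ⟨h2, rfl⟩, h1, by linarith, by linarith⟩
    · rintro ⟨z, ⟨h2, rfl⟩, h1, h3, h4⟩
      exact ⟨h1, h2, by linarith, by linarith⟩
  have hScont : ContinuousOn (fun q : ℝ × ℝ => f q.1 + g q.2 + a * (u q - m) ^ 2) S := by
    refine (hcont.mono fun q hq => hq.1).add (ContinuousOn.mul continuousOn_const ?_)
    exact (((h.smooth.continuousOn).mono fun q hq => hq.2.1).sub continuousOn_const).pow 2
  obtain ⟨p, ⟨hpB, hpΩ, hpT⟩, hpmin⟩ := hSc.exists_isMinOn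
    ⟨p₀, hp₀B, hp₀, by simp [← hm, hTpos.le]⟩ hScont
  have hp0 : f p.1 + g p.2 + a * (u p - m) ^ 2 < 0 := by
    have := hpmin (show p₀ ∈ S from ⟨hp₀B, hp₀, by simp [← hm, hTpos.le]⟩)
    simp only [Set.mem_ofPred_eq, ← hm, sub_self] at this
    linarith
  have hlt : |u p - m| < T := by
    refine lt_of_le_of_ne hpT fun he => ?_
    have : (u p - m) ^ 2 = T ^ 2 := by rw [← sq_abs, he]
    rw [this, haT] at hp0
    linarith [hA p hpB]
  have hpn : B ∈ nhds p := by
    by_contra hn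
    have h1 := hbd p hpB hpΩ (by nlinarith [sq_nonneg (u p - m)]) hn
    have h2 : |m| ≤ |u p| + |u p - m| := by
      have := abs_sub_abs_le_abs_sub m (u p)
      rw [abs_sub_comm m (u p)] at this; linarith
    linarith
  have hloc : IsLocalMin (fun q : ℝ × ℝ => f q.1 + g q.2 + a * (u q - m) ^ 2) p := by
    have hcu : ContinuousAt u p := (differentiableAt_of_smooth h.isOpen h.smooth hpΩ).continuousAt
    have hev : ∀ᶠ q in nhds p, |u q - m| < T :=
      ((hcu.sub continuousAt_const).abs).eventually_lt_const hlt
    filter_upwards [hpn, h.isOpen.mem_nhds hpΩ, hev] with q h1 h2 h3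
    exact hpmin ⟨h1, h2, h3.le⟩
  have key := barrier_line_conditions h.isOpen h.smooth hpΩ hpn hf hg a m hloc
  obtain ⟨k1, d1⟩ := key (1, 0)
  obtain ⟨k2, d2⟩ := key (0, 1)
  obtain ⟨-, d3⟩ := key (pdt u p, - pds u p)
  have hpde := h.pde p hpΩ
  have hgr := hgrad p hpB
  have hla := hlap p hpB
  have hta := htan p hpB
  simp only [mul_one, mul_zero, add_zero, one_mul, zero_mul, zero_add, one_pow, ne_eq,
    OfNat.ofNat_ne_zero, not_false_eq_true, zero_pow] at k1 k2 d1 d2 d3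
  change (1 + (pdt u p) ^ 2) * pds (pds u) p
      - 2 * pds u p * pdt u p * pdt (pds u) p
      + (1 + (pds u p) ^ 2) * pdt (pdt u) p
    = (1 + (pds u p) ^ 2 + (pdt u p) ^ 2) * (s - pdt u p * c) at hpde
  generalize pds (pds u) p = uss at *
  generalize pdt (pds u) p = ust at *
  generalize pdt (pdt u) p = utt at *
  generalize pds u p = us at *
  generalize pdt u p = ut at *
  generalize f' p.1 = F1 at *
  generalize g' p.2 = G1 at *
  generalize f'' p.1 = F2 at *
  generalize g'' p.2 = G2 at *
  exact barrier_arithmetic hA1 hTpos hθ hδ hT0 hT1 hT3 hT2 ha h.abs_s hpT k1 k2 d1 d2 d3 hpde hgr hla hta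

end Barrier

section Filling

variable {Ω B : Set (ℝ × ℝ)} {u : ℝ × ℝ → ℝ} {f f' f'' g g' g'' : ℝ → ℝ} {c s : ℝ}

/-- The height function of a complete graph is unbounded near boundary points of its domain. -/
lemma PlanarTranslator.mem_of_bounded (h : PlanarTranslator c s Ω u) {A : Set (ℝ × ℝ)} {M : ℝ}
    (hA : A ⊆ Ω) (hM : ∀ q ∈ A, |u q| ≤ M) {q : ℝ × ℝ} (hq : q ∈ closure A) : q ∈ Ω := by
  have hc : IsCompact ({x : (ℝ × ℝ) × ℝ | x.1 ∈ Ω ∧ x.2 = u x.1}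
      ∩ closedBall q 1 ×ˢ Set.Icc (-M) M) :=
    ((isCompact_closedBall q 1).prod isCompact_Icc).inter_left h.closed
  have hi := (hc.image continuous_fst).isClosed
  have hsub : A ∩ ball q 1 ⊆ Prod.fst '' ({x : (ℝ × ℝ) × ℝ | x.1 ∈ Ω ∧ x.2 = u x.1}
      ∩ closedBall q 1 ×ˢ Set.Icc (-M) M) := fun p hp =>
    ⟨(p, u p), ⟨⟨hA hp.1, rfl⟩, ball_subset_closedBall hp.2, abs_le.1 (hM p hp.1)⟩, rfl⟩
  have hq' : q ∈ closure (A ∩ ball q 1) := by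
    rw [Set.inter_comm]
    exact isOpen_ball.inter_closure ⟨mem_ball_self one_pos, hq⟩
  obtain ⟨x, hx, rfl⟩ := hi.closure_subset_iff.2 hsub hq'
  exact hx.1.1

/-- A strict barrier forces limit points of the domain behind it to lie in the domain. -/
lemma PlanarTranslator.mem_of_barrier (h : PlanarTranslator c s Ω u) (hBc : IsCompact B)
    (hf : ∀ q ∈ B, HasDerivAt f (f' q.1) q.1 ∧ HasDerivAt f' (f'' q.1) q.1)
    (hg : ∀ q ∈ B, HasDerivAt g (g' q.2) q.2 ∧ HasDerivAt g' (g'' q.2) q.2)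
    {θ K δ : ℝ} (hθ : 0 < θ) (hδ : 0 < δ)
    (hgrad : ∀ q ∈ B, δ ≤ f' q.1 ^ 2 + g' q.2 ^ 2)
    (hlap : ∀ q ∈ B, f'' q.1 + g'' q.2 + c * g' q.2 ≤ K)
    (htan : ∀ q ∈ B, f'' q.1 * g' q.2 ^ 2 + g'' q.2 * f' q.1 ^ 2
      + c * g' q.2 * (f' q.1 ^ 2 + g' q.2 ^ 2) ≤ - θ * (f' q.1 ^ 2 + g' q.2 ^ 2))
    {Z A : Set (ℝ × ℝ)} (hZc : IsCompact Z) (hZ : Z ⊆ Ω)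
    (hbd : ∀ q ∈ B, f q.1 + g q.2 < 0 → B ∉ nhds q → q ∈ Z)
    (hAB : A ⊆ B) (hAΩ : A ⊆ Ω) (hA : ∀ q ∈ A, f q.1 + g q.2 < 0)
    {q : ℝ × ℝ} (hq : q ∈ closure A) : q ∈ Ω := by
  obtain ⟨M, hM⟩ := hZc.exists_bound_of_continuousOn (h.smooth.continuousOn.mono hZ)
  obtain ⟨M', hM'⟩ := h.bounded_of_barrier hBc hf hg hθ hδ hgrad hlap htan
    (fun q h1 _ h3 h4 => hM q (hbd q h1 h3 h4))
  exact h.mem_of_bounded hAΩ (fun q hq => hM' q (hAB hq) (hAΩ hq) (hA q hq)) hq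

/-- The domain can be filled in across vertical segments from one side. -/
lemma PlanarTranslator.fill_vertical (h : PlanarTranslator c s Ω u) {τ ε x₀ t₁ t₂ : ℝ}
    (hτ : τ ^ 2 = 1) (hε : 0 < ε) (h1 : (x₀, t₁) ∈ Ω) (h2 : (x₀, t₂) ∈ Ω)
    (hfill : ∀ r ∈ Set.Ioo 0 ε, ∀ t ∈ Set.Icc t₁ t₂, (x₀ + τ * r, t) ∈ Ω) :
    ∀ t ∈ Set.Icc t₁ t₂, (x₀, t) ∈ Ω := by
  obtain ⟨e, he, heε, hb1, hb2⟩ : ∃ e : ℝ, 0 < e ∧ e < ε ∧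
      (∀ x ∈ Set.Icc (x₀ - e) (x₀ + e), (x, t₁) ∈ Ω) ∧
      (∀ x ∈ Set.Icc (x₀ - e) (x₀ + e), (x, t₂) ∈ Ω) := by
    have aux : ∀ t, (x₀, t) ∈ Ω → ∃ e : ℝ, 0 < e ∧ ∀ x ∈ Set.Icc (x₀ - e) (x₀ + e), (x, t) ∈ Ω := by
      intro t ht
      have hc : Continuous fun x : ℝ => (x, t) := by fun_prop
      obtain ⟨e, he, hs⟩ := nhds_basis_closedBall.mem_iff.1
        ((h.isOpen.preimage hc).mem_nhds (show x₀ ∈ _ from ht))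
      rw [Real.closedBall_eq_Icc] at hs
      exact ⟨e, he, hs⟩
    obtain ⟨e, he, hs⟩ := aux _ h1
    obtain ⟨e', he', hs'⟩ := aux _ h2
    have m1 := min_le_left (min e e') (ε / 2)
    have m2 := min_le_right (min e e') (ε / 2)
    have m3 := min_le_left e e'
    have m4 := min_le_right e e'
    refine ⟨min (min e e') (ε / 2), by positivity, by linarith, fun x hx => hs x ⟨?_, ?_⟩,
      fun x hx => hs' x ⟨?_, ?_⟩⟩ <;> linarith [hx.1, hx.2]
  intro t₃ ht₃
  set κ : ℝ := min e (1 / 3) with hκ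
  have hκ0 : 0 < κ := by positivity
  have hκe : κ ≤ e := min_le_left _ _
  have hκ3 : κ ≤ 1 / 3 := min_le_right _ _
  have hτ' : τ = 1 ∨ τ = -1 := mul_self_eq_one_iff.1 (by rwa [← sq])
  set E : ℝ → ℝ := fun t => κ * exp (3 * (t - t₂)) with hE
  have hE' : ∀ t, HasDerivAt E (3 * E t) t := fun t => by
    have := (((hasDerivAt_id t).sub_const t₂).const_mul 3).exp.const_mul κ
    exact this.congr_deriv (by simp [hE]; ring)
  have hE0 : ∀ t, 0 < E t := fun t => by positivity
  have hE1 : ∀ t ≤ t₂, E t ≤ κ := fun t ht =>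
    mul_le_of_le_one_right hκ0.le (exp_le_one_iff.2 (by linarith))
  have hE2 : ∀ t, t₁ ≤ t → E t₁ ≤ E t := fun t ht => by
    simp only [hE]; gcongr
  have hc := abs_le.1 h.abs_c
  refine h.mem_of_barrier (B := Set.Icc (x₀ - e) (x₀ + e) ×ˢ Set.Icc t₁ t₂)
    (f := fun x => -τ * (x - x₀)) (f' := fun _ => -τ) (f'' := fun _ => 0)
    (g := fun t => - E t) (g' := fun t => - (3 * E t)) (g'' := fun t => - (3 * (3 * E t)))
    (θ := E t₁) (K := 0) (δ := 1)
    (Z := (fun x => (x, t₁)) '' Set.Icc (x₀ - e) (x₀ + e) ∪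
      (fun x => (x, t₂)) '' Set.Icc (x₀ - e) (x₀ + e) ∪
      (fun t => (x₀ + τ * e, t)) '' Set.Icc t₁ t₂)
    (A := (fun r => (x₀ + τ * r, t₃)) '' Set.Ioo 0 e)
    (isCompact_Icc.prod isCompact_Icc) ?_ ?_ (hE0 _) one_pos ?_ ?_ ?_ ?_ ?_ ?_ ?_ ?_ ?_ ?_
  · intro q hq
    refine ⟨?_, hasDerivAt_const _ _⟩
    simpa using ((hasDerivAt_id q.1).sub_const x₀).const_mul (-τ)
  · exact fun q hq => ⟨(hE' _).neg, ((hE' _).const_mul 3).neg⟩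
  · intro q hq
    nlinarith [sq_nonneg (3 * E q.2)]
  · intro q hq
    nlinarith [hE0 q.2]
  · intro q hq
    have e1 := hE0 q.2
    have e2 := hE1 q.2 hq.2.2
    have e3 := hE2 q.2 hq.2.1
    simp only [neg_sq, hτ]
    generalize E q.2 = y at *
    generalize E t₁ = z at *
    have e5 : 1 + (3 * y) ^ 2 ≤ 2 := by nlinarith
    have e6 : c * -(3 * y) * (1 + (3 * y) ^ 2) ≤ 3 * y * 2 := by
      have : c * -(3 * y) ≤ 3 * y := by nlinarith
      have h0 : 0 ≤ 1 + (3 * y) ^ 2 := by positivity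
      nlinarith
    have e7 : z * (1 + (3 * y) ^ 2) ≤ y * 2 := by gcongr
    nlinarith
  · refine (((isCompact_Icc.image ?_).union (isCompact_Icc.image ?_)).union
      (isCompact_Icc.image ?_)) <;> fun_prop
  · rintro _ ((⟨x, hx, rfl⟩ | ⟨x, hx, rfl⟩) | ⟨t, ht, rfl⟩)
    · exact hb1 x hx
    · exact hb2 x hx
    · exact hfill e ⟨he, heε⟩ t ht
  · rintro ⟨x, t⟩ ⟨hx, ht⟩ hneg hn
    simp only at hx ht hneg
    by_cases e1 : t = t₁
    · subst e1; exact Or.inl (Or.inl ⟨x, hx, rfl⟩)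
    by_cases e2 : t = t₂
    · subst e2; exact Or.inl (Or.inr ⟨x, hx, rfl⟩)
    by_cases e3 : x = x₀ + τ * e
    · subst e3; exact Or.inr ⟨t, ht, rfl⟩
    exfalso
    apply hn
    have e4 : x ≠ x₀ - τ * e := by
      rintro rfl
      have := hE1 t ht.2
      nlinarith
    refine prod_mem_nhds (Icc_mem_nhds ?_ ?_) (Icc_mem_nhds (lt_of_le_of_ne ht.1 (Ne.symm e1))
      (lt_of_le_of_ne ht.2 e2))
    · refine lt_of_le_of_ne hx.1 ?_
      rintro rfl
      rcases hτ' with rfl | rfl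
      · exact e4 (by ring)
      · exact e3 (by ring)
    · refine lt_of_le_of_ne hx.2 ?_
      rintro rfl
      rcases hτ' with rfl | rfl
      · exact e3 (by ring)
      · exact e4 (by ring)
  · rintro _ ⟨r, hr, rfl⟩
    refine ⟨?_, ht₃⟩
    rcases hτ' with rfl | rfl
    · constructor <;> simp <;> linarith [hr.1, hr.2]
    · constructor <;> simp <;> linarith [hr.1, hr.2]
  · rintro _ ⟨r, hr, rfl⟩
    exact hfill r ⟨hr.1, hr.2.trans heε⟩ t₃ ht₃
  · rintro _ ⟨r, hr, rfl⟩
    have := hE0 t₃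
    have := hr.1
    simp only
    nlinarith
  · have hcl : (0 : ℝ) ∈ closure (Set.Ioo 0 e) := by
      rw [closure_Ioo he.ne]; exact ⟨le_rfl, he.le⟩
    have hcc : Continuous fun r : ℝ => (x₀ + τ * r, t₃) := by fun_prop
    simpa using image_closure_subset_closure_image hcc ⟨0, hcl, rfl⟩

end Filling

section Reaper

/-- Minus the grim reaper profile of speed `c`. -/
def reaper (c x : ℝ) : ℝ := log (cos (c * x)) / c

variable {c x : ℝ}

lemma abs_mul_lt_one (hc : |c| ≤ 1) (hx : |x| < 1) : |c * x| < 1 := by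
  rw [abs_mul]; nlinarith [abs_nonneg c, abs_nonneg x]

lemma half_le_cos_of_abs_lt_one (hx : |x| < 1) : 1 / 2 ≤ cos x := by
  have h1 := one_sub_sq_div_two_le_cos (x := x)
  have h2 : x ^ 2 ≤ 1 := by rw [← sq_abs]; nlinarith [abs_nonneg x]
  linarith

lemma hasDerivAt_reaper (hc : |c| ≤ 1) (hx : |x| < 1) :
    HasDerivAt (reaper c) (-tan (c * x)) x := by
  have h := half_le_cos_of_abs_lt_one (abs_mul_lt_one hc hx)
  have hne : cos (c * x) ≠ 0 := by linarith
  have h1 : HasDerivAt (fun x => c * x) c x := by simpa using (hasDerivAt_id x).const_mul c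
  refine ((h1.cos.log hne).div_const c).congr_deriv ?_
  rcases eq_or_ne c 0 with rfl | h0
  · simp
  · rw [tan_eq_sin_div_cos]; field_simp

lemma hasDerivAt_neg_tan_mul (hc : |c| ≤ 1) (hx : |x| < 1) :
    HasDerivAt (fun x => -tan (c * x)) (-c * (1 + (-tan (c * x)) ^ 2)) x := by
  have h := half_le_cos_of_abs_lt_one (abs_mul_lt_one hc hx)
  have hne : cos (c * x) ≠ 0 := by linarith
  have h1 : HasDerivAt (fun x => c * x) c x := by simpa using (hasDerivAt_id x).const_mul c
  refine ((hasDerivAt_tan hne).comp x h1).neg.congr_deriv ?_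
  rw [tan_eq_sin_div_cos]
  field_simp
  linear_combination c * sin_sq_add_cos_sq (c * x)

lemma abs_tan_mul_le_two (hc : |c| ≤ 1) (hx : |x| < 1) : |-tan (c * x)| ≤ 2 := by
  have h := half_le_cos_of_abs_lt_one (abs_mul_lt_one hc hx)
  rw [abs_neg, tan_eq_sin_div_cos, abs_div, abs_of_pos (by linarith : 0 < cos (c * x)),
    div_le_iff₀ (by linarith)]
  linarith [abs_sin_le_one (c * x)]

lemma reaper_zero : reaper c 0 = 0 := by simp [reaper]

lemma abs_reaper_le_one (hc : |c| ≤ 1) (hx : |x| ≤ 1 / 2) : |reaper c x| ≤ 1 := by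
  have h1 := abs_le.1 hx
  have := (convex_Icc (-(1 / 2) : ℝ) (1 / 2)).norm_image_sub_le_of_norm_hasDerivWithin_le
    (f := reaper c) (f' := fun x => -tan (c * x)) (C := 2) (x := 0) (y := x)
    (fun y hy => (hasDerivAt_reaper hc (by rw [abs_lt]; constructor <;>
      linarith [hy.1, hy.2])).hasDerivWithinAt)
    (fun y hy => abs_tan_mul_le_two hc (by rw [abs_lt]; constructor <;>
      linarith [hy.1, hy.2])) (by constructor <;> norm_num) h1
  rw [reaper_zero, sub_zero, sub_zero, norm_eq_abs, norm_eq_abs] at this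
  linarith

end Reaper

section Filling

variable {Ω : Set (ℝ × ℝ)} {u : ℝ × ℝ → ℝ} {c s : ℝ}

lemma grim_barrier_ineq {c τ d y z : ℝ} (hc : |c| ≤ 1) (hτ : τ ^ 2 = 1) (hd : |d| ≤ 2)
    (hz : 0 < z) (hzy : z ≤ y) (hy : y ≤ 1 / 4) :
    (-τ * (-c * (1 + d ^ 2)) - 8 * (8 * y)) * (-τ) ^ 2 + 0 * (-τ * d - 8 * y) ^ 2
      + c * -τ * ((-τ * d - 8 * y) ^ 2 + (-τ) ^ 2)
      ≤ -(z / 2) * ((-τ * d - 8 * y) ^ 2 + (-τ) ^ 2) := by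
  have hcτ : |c * τ| ≤ 1 := by
    have : |τ| = 1 := by
      rw [← sq_abs] at hτ; nlinarith [abs_nonneg τ]
    rw [abs_mul, this, mul_one]; exact hc
  have hcd : |c * d| ≤ 2 := by rw [abs_mul]; nlinarith [abs_nonneg c, abs_nonneg d]
  have hτd : |τ * d| ≤ 2 := by
    have : |τ| = 1 := by
      rw [← sq_abs] at hτ; nlinarith [abs_nonneg τ]
    rw [abs_mul, this, one_mul]; exact hd
  have e1 : (-τ * (-c * (1 + d ^ 2)) - 8 * (8 * y)) * (-τ) ^ 2 + 0 * (-τ * d - 8 * y) ^ 2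
      + c * -τ * ((-τ * d - 8 * y) ^ 2 + (-τ) ^ 2)
      = -64 * y - 16 * (c * d) * y - 64 * (c * τ) * y ^ 2 := by
    linear_combination (τ * c * (1 + d ^ 2) - 64 * y - 16 * c * d * y - c * τ - c * τ * d ^ 2) * hτ
  have e2 : (-τ * d - 8 * y) ^ 2 + (-τ) ^ 2 ≤ 32 := by
    rw [neg_sq, hτ]
    have := abs_le.1 hτd
    nlinarith
  rw [e1]
  have h1 := abs_le.1 hcτ
  have h2 := abs_le.1 hcd
  have h3 : -16 * (c * d) * y ≤ 32 * y := by nlinarith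
  have h4 : -64 * (c * τ) * y ^ 2 ≤ 16 * y := by nlinarith [sq_nonneg y]
  have h5 : z / 2 * ((-τ * d - 8 * y) ^ 2 + (-τ) ^ 2) ≤ y / 2 * 32 := by gcongr; linarith
  linarith

/-- The domain can be filled in along the leaves of the foliation by translated copies of a grim
reaper from one side. -/
lemma PlanarTranslator.fill_grim (h : PlanarTranslator c s Ω u) {l l' : ℝ → ℝ}
    {τ ε σ₀ x₁ x₂ : ℝ} (hτ : τ ^ 2 = 1) (hε : 0 < ε)
    (hl : ∀ x ∈ Set.Icc x₁ x₂, HasDerivAt l (l' x) x)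
    (hl' : ∀ x ∈ Set.Icc x₁ x₂, HasDerivAt l' (-c * (1 + l' x ^ 2)) x)
    (hb : ∀ x ∈ Set.Icc x₁ x₂, |l' x| ≤ 2)
    (h1 : (x₁, σ₀ - l x₁) ∈ Ω) (h2 : (x₂, σ₀ - l x₂) ∈ Ω)
    (hfill : ∀ r ∈ Set.Ioo 0 ε, ∀ x ∈ Set.Icc x₁ x₂, (x, σ₀ + τ * r - l x) ∈ Ω) :
    ∀ x ∈ Set.Icc x₁ x₂, (x, σ₀ - l x) ∈ Ω := by
  obtain ⟨e, he, heε, hb1, hb2⟩ : ∃ e : ℝ, 0 < e ∧ e < ε ∧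
      (∀ y ∈ Set.Icc (σ₀ - e) (σ₀ + e), (x₁, y - l x₁) ∈ Ω) ∧
      (∀ y ∈ Set.Icc (σ₀ - e) (σ₀ + e), (x₂, y - l x₂) ∈ Ω) := by
    have aux : ∀ x, (x, σ₀ - l x) ∈ Ω →
        ∃ e : ℝ, 0 < e ∧ ∀ y ∈ Set.Icc (σ₀ - e) (σ₀ + e), (x, y - l x) ∈ Ω := by
      intro x hx
      have hc : Continuous fun y : ℝ => (x, y - l x) := by fun_prop
      obtain ⟨e, he, hs⟩ := nhds_basis_closedBall.mem_iff.1
        ((h.isOpen.preimage hc).mem_nhds (show σ₀ ∈ _ from hx))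
      rw [Real.closedBall_eq_Icc] at hs
      exact ⟨e, he, hs⟩
    obtain ⟨e, he, hs⟩ := aux _ h1
    obtain ⟨e', he', hs'⟩ := aux _ h2
    have m1 := min_le_left (min e e') (ε / 2)
    have m2 := min_le_right (min e e') (ε / 2)
    have m3 := min_le_left e e'
    have m4 := min_le_right e e'
    refine ⟨min (min e e') (ε / 2), by positivity, by linarith, fun x hx => hs x ⟨?_, ?_⟩,
      fun x hx => hs' x ⟨?_, ?_⟩⟩ <;> linarith [hx.1, hx.2]
  intro x₃ hx₃
  set κ : ℝ := min e (1 / 4) with hκ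
  have hκ0 : 0 < κ := by positivity
  have hκe : κ ≤ e := min_le_left _ _
  have hκ3 : κ ≤ 1 / 4 := min_le_right _ _
  have hτ' : τ = 1 ∨ τ = -1 := mul_self_eq_one_iff.1 (by rwa [← sq])
  set E : ℝ → ℝ := fun x => κ * exp (8 * (x - x₂)) with hE
  have hE' : ∀ t, HasDerivAt E (8 * E t) t := fun t => by
    have := (((hasDerivAt_id t).sub_const x₂).const_mul 8).exp.const_mul κ
    exact this.congr_deriv (by simp [hE]; ring)
  have hE0 : ∀ t, 0 < E t := fun t => by positivity
  have hE1 : ∀ t ≤ x₂, E t ≤ κ := fun t ht =>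
    mul_le_of_le_one_right hκ0.le (exp_le_one_iff.2 (by linarith))
  have hE2 : ∀ t, x₁ ≤ t → E x₁ ≤ E t := fun t ht => by
    simp only [hE]; gcongr
  have hc := abs_le.1 h.abs_c
  have hlc : ContinuousOn l (Set.Icc x₁ x₂) := fun x hx => (hl x hx).continuousAt.continuousWithinAt
  have hmem : ∀ x y : ℝ, x ∈ Set.Icc x₁ x₂ → y ∈ Set.Icc (σ₀ - e) (σ₀ + e) →
      (x, y - l x) ∈ (fun q : ℝ × ℝ => (q.1, q.2 - l q.1)) ''
        (Set.Icc x₁ x₂ ×ˢ Set.Icc (σ₀ - e) (σ₀ + e)) := fun x y hx hy => ⟨(x, y), ⟨hx, hy⟩, rfl⟩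
  have hBsub : ∀ q ∈ (fun q : ℝ × ℝ => (q.1, q.2 - l q.1)) ''
        (Set.Icc x₁ x₂ ×ˢ Set.Icc (σ₀ - e) (σ₀ + e)), q.1 ∈ Set.Icc x₁ x₂ := by
    rintro _ ⟨q, hq, rfl⟩; exact hq.1
  refine h.mem_of_barrier (B := (fun q : ℝ × ℝ => (q.1, q.2 - l q.1)) ''
      (Set.Icc x₁ x₂ ×ˢ Set.Icc (σ₀ - e) (σ₀ + e)))
    (f := fun x => -τ * l x - E x) (f' := fun x => -τ * l' x - 8 * E x)
    (f'' := fun x => -τ * (-c * (1 + l' x ^ 2)) - 8 * (8 * E x))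
    (g := fun t => -τ * (t - σ₀)) (g' := fun t => -τ) (g'' := fun t => 0)
    (θ := E x₁ / 2) (K := 6) (δ := 1)
    (Z := (fun y => (x₁, y - l x₁)) '' Set.Icc (σ₀ - e) (σ₀ + e) ∪
      (fun y => (x₂, y - l x₂)) '' Set.Icc (σ₀ - e) (σ₀ + e) ∪
      (fun x => (x, σ₀ + τ * e - l x)) '' Set.Icc x₁ x₂)
    (A := (fun r => (x₃, σ₀ + τ * r - l x₃)) '' Set.Ioo 0 e)
    ?_ ?_ ?_ (half_pos (hE0 _)) one_pos ?_ ?_ ?_ ?_ ?_ ?_ ?_ ?_ ?_ ?_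
  · refine (isCompact_Icc.prod isCompact_Icc).image_of_continuousOn ?_
    refine continuousOn_fst.prodMk (continuousOn_snd.sub ?_)
    exact hlc.comp continuousOn_fst fun q hq => hq.1
  · intro q hq
    have hx := hBsub q hq
    exact ⟨((hl _ hx).const_mul _).sub (hE' _), ((hl' _ hx).const_mul _).sub ((hE' _).const_mul 8)⟩
  · intro q hq
    refine ⟨?_, hasDerivAt_const _ _⟩
    simpa using ((hasDerivAt_id q.2).sub_const σ₀).const_mul (-τ)
  · intro q hq
    nlinarith [sq_nonneg (-τ * l' q.1 - 8 * E q.1)]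
  · intro q hq
    have hx := hBsub q hq
    have := hE0 q.1
    have h3 : l' q.1 ^ 2 ≤ 4 := by
      rw [← sq_abs]; nlinarith [hb _ hx, abs_nonneg (l' q.1)]
    have h4 : -1 ≤ c * τ ∧ c * τ ≤ 1 := by
      rcases hτ' with rfl | rfl <;> constructor <;> linarith
    nlinarith [sq_nonneg (l' q.1)]
  · intro q hq
    have hx := hBsub q hq
    exact grim_barrier_ineq h.abs_c hτ (hb _ hx) (hE0 _) (hE2 _ hx.1) ((hE1 _ hx.2).trans hκ3)
  · refine ((isCompact_Icc.image ?_).union (isCompact_Icc.image ?_)).union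
      (isCompact_Icc.image_of_continuousOn ?_)
    · fun_prop
    · fun_prop
    · exact continuousOn_id.prodMk (continuousOn_const.sub hlc)
  · rintro _ ((⟨x, hx, rfl⟩ | ⟨x, hx, rfl⟩) | ⟨t, ht, rfl⟩)
    · exact hb1 x hx
    · exact hb2 x hx
    · exact hfill e ⟨he, heε⟩ t ht
  · rintro _ ⟨⟨x, y⟩, ⟨hx, hy⟩, rfl⟩ hneg hn
    simp only at hx hy hneg hn ⊢
    by_cases e1 : x = x₁
    · subst e1; exact Or.inl (Or.inl ⟨y, hy, rfl⟩)
    by_cases e2 : x = x₂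
    · subst e2; exact Or.inl (Or.inr ⟨y, hy, rfl⟩)
    by_cases e3 : y = σ₀ + τ * e
    · subst e3; exact Or.inr ⟨x, hx, rfl⟩
    exfalso
    apply hn
    have e4 : y ≠ σ₀ - τ * e := by
      rintro rfl
      have := hE1 x hx.2
      nlinarith
    have hy1 : σ₀ - e < y := by
      refine lt_of_le_of_ne hy.1 ?_
      rintro rfl
      rcases hτ' with rfl | rfl
      · exact e4 (by ring)
      · exact e3 (by ring)
    have hy2 : y < σ₀ + e := by
      refine lt_of_le_of_ne hy.2 ?_
      rintro rfl
      rcases hτ' with rfl | rfl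
      · exact e3 (by ring)
      · exact e4 (by ring)
    have hct : ContinuousAt (fun q : ℝ × ℝ => q.2 + l q.1) (x, y - l x) :=
      continuousAt_snd.add (ContinuousAt.comp (hl x hx).continuousAt continuousAt_fst)
    have ev1 : ∀ᶠ q : ℝ × ℝ in nhds (x, y - l x), q.2 + l q.1 ∈ Set.Ioo (σ₀ - e) (σ₀ + e) :=
      hct.eventually_mem (by
        simp only [sub_add_cancel]; exact Ioo_mem_nhds hy1 hy2)
    have ev2 : ∀ᶠ q : ℝ × ℝ in nhds (x, y - l x), q.1 ∈ Set.Ioo x₁ x₂ :=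
      continuousAt_fst.eventually_mem
        (Ioo_mem_nhds (lt_of_le_of_ne hx.1 (Ne.symm e1)) (lt_of_le_of_ne hx.2 e2))
    filter_upwards [ev1, ev2] with q h3 h4
    exact ⟨(q.1, q.2 + l q.1), ⟨Set.Ioo_subset_Icc_self h4, Set.Ioo_subset_Icc_self h3⟩, by simp⟩
  · rintro _ ⟨r, hr, rfl⟩
    refine hmem _ _ hx₃ ?_
    rcases hτ' with rfl | rfl
    · constructor <;> linarith [hr.1, hr.2]
    · constructor <;> linarith [hr.1, hr.2]
  · rintro _ ⟨r, hr, rfl⟩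
    exact hfill r ⟨hr.1, hr.2.trans heε⟩ x₃ hx₃
  · rintro _ ⟨r, hr, rfl⟩
    have := hE0 x₃
    have := hr.1
    simp only
    nlinarith
  · have hcl : (0 : ℝ) ∈ closure (Set.Ioo 0 e) := by
      rw [closure_Ioo he.ne]; exact ⟨le_rfl, he.le⟩
    have hcc : Continuous fun r : ℝ => (x₃, σ₀ + τ * r - l x₃) := by fun_prop
    simpa using image_closure_subset_closure_image hcc ⟨0, hcl, rfl⟩

end Filling

section Slices

/-- Every vertical slice of the planar set is an interval. -/
def VerticallyConvex (V : Set (ℝ × ℝ)) : Prop :=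
  ∀ x t₁ t₂, (x, t₁) ∈ V → (x, t₂) ∈ V → ∀ t ∈ Set.Icc t₁ t₂, (x, t) ∈ V

/-- A vertical segment with end points in the set is contained in the set as soon as all nearby
parallel segments on one side are. -/
def VerticallyFillable (Ω : Set (ℝ × ℝ)) : Prop :=
  ∀ τ ε x₀ t₁ t₂ : ℝ, τ ^ 2 = 1 → 0 < ε → (x₀, t₁) ∈ Ω → (x₀, t₂) ∈ Ω →
    (∀ r ∈ Set.Ioo 0 ε, ∀ t ∈ Set.Icc t₁ t₂, (x₀ + τ * r, t) ∈ Ω) →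
    ∀ t ∈ Set.Icc t₁ t₂, (x₀, t) ∈ Ω

variable {Ω O B V : Set (ℝ × ℝ)}

lemma VerticallyConvex.uIcc (hV : VerticallyConvex V) {x t₁ t₂ t : ℝ} (h1 : (x, t₁) ∈ V)
    (h2 : (x, t₂) ∈ V) (ht : t ∈ Set.uIcc t₁ t₂) : (x, t) ∈ V := by
  rcases Set.mem_uIcc.1 ht with h | h
  · exact hV x t₁ t₂ h1 h2 t h
  · exact hV x t₂ t₁ h2 h1 t h

lemma VerticallyFillable.uIcc (hΩ : VerticallyFillable Ω) {τ ε x₀ t₁ t₂ : ℝ} (hτ : τ ^ 2 = 1)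
    (hε : 0 < ε) (h1 : (x₀, t₁) ∈ Ω) (h2 : (x₀, t₂) ∈ Ω)
    (hf : ∀ r ∈ Set.Ioo 0 ε, ∀ t ∈ Set.uIcc t₁ t₂, (x₀ + τ * r, t) ∈ Ω) :
    ∀ t ∈ Set.uIcc t₁ t₂, (x₀, t) ∈ Ω := by
  rcases le_total t₁ t₂ with h | h
  · rw [Set.uIcc_of_le h] at *; exact hΩ τ ε x₀ t₁ t₂ hτ hε h1 h2 hf
  · rw [Set.uIcc_of_ge h] at *; exact hΩ τ ε x₀ t₂ t₁ hτ hε h2 h1 hf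

lemma isPreconnected_of_verticallyConvex (hV : IsOpen V) (hc : VerticallyConvex V)
    (hp : IsPreconnected (Prod.fst '' V)) : IsPreconnected V := by
  intro u v hu hv hsub hVu hVv
  obtain ⟨x, -, ⟨⟨_, t₁⟩, ⟨h1, h1'⟩, rfl⟩, ⟨⟨x, t₂⟩, ⟨h2, h2'⟩, rfl⟩⟩ :=
    hp (Prod.fst '' (V ∩ u)) (Prod.fst '' (V ∩ v))
    (isOpenMap_fst _ (hV.inter hu)) (isOpenMap_fst _ (hV.inter hv))
    (by
      rintro _ ⟨q, hq, rfl⟩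
      rcases hsub hq with h | h
      · exact Or.inl ⟨q, ⟨hq, h⟩, rfl⟩
      · exact Or.inr ⟨q, ⟨hq, h⟩, rfl⟩)
    (by
      obtain ⟨q, hq⟩ := hVu
      exact ⟨q.1, ⟨q, hq.1, rfl⟩, q, hq, rfl⟩)
    (by
      obtain ⟨q, hq⟩ := hVv
      exact ⟨q.1, ⟨q, hq.1, rfl⟩, q, hq, rfl⟩)
  have hcont : Continuous fun t : ℝ => (x, t) := by fun_prop
  have hpre : IsPreconnected ((fun t : ℝ => (x, t)) '' Set.uIcc t₁ t₂) :=
    isPreconnected_uIcc.image _ hcont.continuousOn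
  have hs : (fun t : ℝ => (x, t)) '' Set.uIcc t₁ t₂ ⊆ V := by
    rintro _ ⟨t, ht, rfl⟩; exact hc.uIcc h1 h2 ht
  obtain ⟨q, hq, hq'⟩ := hpre u v hu hv (hs.trans hsub) ⟨_, ⟨t₁, Set.left_mem_uIcc, rfl⟩, h1'⟩
    ⟨_, ⟨t₂, Set.right_mem_uIcc, rfl⟩, h2'⟩
  exact ⟨q, hs hq, hq'⟩

/-- Vertical segments joining two vertically convex sets propagate over an interval. -/
lemma VerticallyFillable.propagate (hΩ : VerticallyFillable Ω) (hΩo : IsOpen Ω) (hO : IsOpen O)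
    (hB : IsOpen B) (hOc : VerticallyConvex O) (hBc : VerticallyConvex B) (hOΩ : O ⊆ Ω)
    (hBΩ : B ⊆ Ω) {x₀ τ R : ℝ} (hτ : τ ^ 2 = 1)
    (h0 : ∃ t, (x₀, t) ∈ O ∩ B)
    (hJ : ∀ r ∈ Set.Icc 0 R, x₀ + τ * r ∈ Prod.fst '' O ∩ Prod.fst '' B) :
    ∀ r ∈ Set.Icc 0 R, ∀ t₁ t₂, (x₀ + τ * r, t₁) ∈ O → (x₀ + τ * r, t₂) ∈ B →
      ∀ t ∈ Set.uIcc t₁ t₂, (x₀ + τ * r, t) ∈ Ω := by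
  set P : ℝ → Prop := fun x => ∀ t₁ t₂, (x, t₁) ∈ O → (x, t₂) ∈ B →
      ∀ t ∈ Set.uIcc t₁ t₂, (x, t) ∈ Ω with hP
  have hev : ∀ {W : Set (ℝ × ℝ)}, IsOpen W → ∀ {x t : ℝ}, (x, t) ∈ W →
      ∀ᶠ y in nhds x, (y, t) ∈ W := by
    intro W hW x t hx
    have hc : Continuous fun y : ℝ => (y, t) := by fun_prop
    exact hc.continuousAt.eventually_mem (hW.mem_nhds hx)
  have hex : ∀ x t₁ t₂, (x, t₁) ∈ O → (x, t₂) ∈ B → (∀ t ∈ Set.uIcc t₁ t₂, (x, t) ∈ Ω) → P x := by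
    intro x t₁ t₂ h1 h2 h t₁' t₂' h1' h2' t ht
    rcases Set.uIcc_subset_uIcc_union_uIcc (b := t₁) ht with h3 | h3
    · exact hOΩ (hOc.uIcc h1' h1 h3)
    rcases Set.uIcc_subset_uIcc_union_uIcc (b := t₂) h3 with h4 | h4
    · exact h t h4
    · exact hBΩ (hBc.uIcc h2 h2' h4)
  have hPopen : ∀ x ∈ Prod.fst '' O ∩ Prod.fst '' B, P x → ∀ᶠ y in nhds x, P y := by
    rintro x ⟨⟨⟨_, t₁⟩, h1, rfl⟩, ⟨⟨x, t₂⟩, h2, rfl⟩⟩ hx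
    have ht : ∀ᶠ y in nhds x, ∀ t ∈ Set.uIcc t₁ t₂, (y, t) ∈ Ω := by
      have hc := isCompact_uIcc (a := t₁) (b := t₂)
      refine hc.eventually_forall_of_forall_eventually fun t ht => ?_
      exact hΩo.mem_nhds (hx t₁ t₂ h1 h2 t ht)
    filter_upwards [ht, hev hO h1, hev hB h2] with y h3 h4 h5
    exact hex y t₁ t₂ h4 h5 h3
  by_contra hcon
  simp only [not_forall] at hcon
  obtain ⟨r₁, hr₁, hbad⟩ := hcon
  set N : Set ℝ := {r | r ∈ Set.Icc 0 R ∧ ¬ P (x₀ + τ * r)} with hN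
  have hcτ : Continuous fun r : ℝ => x₀ + τ * r := by fun_prop
  have hNcl : IsClosed N := by
    refine isClosed_of_closure_subset fun r hr => ?_
    have hrR : r ∈ Set.Icc 0 R :=
      closure_minimal (fun x hx => hx.1 : N ⊆ Set.Icc 0 R) isClosed_Icc hr
    refine ⟨hrR, fun hPr => ?_⟩
    have := hcτ.continuousAt.eventually (hPopen _ (hJ r hrR) hPr)
    obtain ⟨y, hy, hy'⟩ := mem_closure_iff_nhds.1 hr _ this
    exact hy'.2 hy
  have hNc : IsCompact N := isCompact_Icc.of_isClosed_subset hNcl fun x hx => hx.1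
  obtain ⟨r, ⟨hrR, hrP⟩, hrmin⟩ := hNc.exists_isLeast ⟨r₁, hr₁, by
    simp only [hP, not_forall]; exact hbad⟩
  have hP0 : P x₀ := by
    obtain ⟨t, h1, h2⟩ := h0
    refine hex x₀ t t h1 h2 fun t' ht' => ?_
    rw [Set.uIcc_self, Set.mem_singleton_iff] at ht'
    exact hOΩ (ht' ▸ h1)
  have hr0 : 0 < r := by
    refine lt_of_le_of_ne hrR.1 ?_
    rintro rfl
    simp [hP0] at hrP
  apply hrP
  intro t₁ t₂ h1 h2
  have e1 : ∀ᶠ y in nhds r, (x₀ + τ * y, t₁) ∈ O ∧ (x₀ + τ * y, t₂) ∈ B :=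
    hcτ.continuousAt.eventually ((hev hO h1).and (hev hB h2))
  obtain ⟨ε, hε, hs⟩ := Metric.eventually_nhds_iff.1 e1
  refine hΩ.uIcc (τ := -τ) (ε := min ε r) (by rwa [neg_sq]) (by positivity) (hOΩ h1) (hBΩ h2) ?_
  intro ρ hρ t ht
  have hρ1 := hρ.2.trans_le (min_le_left _ _)
  have hρ2 := hρ.2.trans_le (min_le_right _ _)
  have e2 := hs (y := r - ρ) (by simp [abs_of_pos hρ.1, hρ1])
  have e3 : P (x₀ + τ * (r - ρ)) := by
    by_contra hb
    have := hrmin (show r - ρ ∈ N from ⟨⟨by linarith, by linarith [hρ.1, hrR.2]⟩, hb⟩)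
    linarith [hρ.1]
  have := e3 t₁ t₂ e2.1 e2.2 t ht
  rwa [show x₀ + τ * r + -τ * ρ = x₀ + τ * (r - ρ) by ring]

/-- The vertical hull of a planar set. -/
def verticalHull (O : Set (ℝ × ℝ)) : Set (ℝ × ℝ) :=
  {q | ∃ t₁ t₂, (q.1, t₁) ∈ O ∧ (q.1, t₂) ∈ O ∧ q.2 ∈ Set.Icc t₁ t₂}

lemma subset_verticalHull : O ⊆ verticalHull O := fun q hq => ⟨q.2, q.2, hq, hq, le_rfl, le_rfl⟩

lemma verticallyConvex_verticalHull : VerticallyConvex (verticalHull O) := by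
  rintro x t₁ t₂ ⟨a, -, ha, -, ha', -⟩ ⟨-, b, -, hb, -, hb'⟩ t ht
  exact ⟨a, b, ha, hb, ha'.trans ht.1, ht.2.trans hb'⟩

lemma isOpen_verticalHull (hO : IsOpen O) : IsOpen (verticalHull O) := by
  rw [isOpen_iff_mem_nhds]
  rintro ⟨x, t⟩ ⟨t₁, t₂, h1, h2, ht1, ht2⟩
  simp only at h1 h2 ht1 ht2
  rcases ht1.eq_or_lt with rfl | h3
  · exact Filter.mem_of_superset (hO.mem_nhds h1) subset_verticalHull
  rcases ht2.eq_or_lt with rfl | h4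
  · exact Filter.mem_of_superset (hO.mem_nhds h2) subset_verticalHull
  have c1 : Continuous fun q : ℝ × ℝ => (q.1, t₁) := by fun_prop
  have c2 : Continuous fun q : ℝ × ℝ => (q.1, t₂) := by fun_prop
  have e1 := (c1.continuousAt (x := (x, t))).eventually_mem (hO.mem_nhds h1)
  have e2 := (c2.continuousAt (x := (x, t))).eventually_mem (hO.mem_nhds h2)
  have e3 : ∀ᶠ q : ℝ × ℝ in nhds (x, t), q.2 ∈ Set.Icc t₁ t₂ :=
    continuousAt_snd.eventually_mem (Icc_mem_nhds h3 h4)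
  filter_upwards [e1, e2, e3] with q h5 h6 h7
  exact ⟨t₁, t₂, h5, h6, h7⟩

lemma image_fst_verticalHull : Prod.fst '' verticalHull O = Prod.fst '' O := by
  refine Set.Subset.antisymm ?_ (Set.image_mono subset_verticalHull)
  rintro _ ⟨q, ⟨t₁, _, h1, _⟩, rfl⟩
  exact ⟨(q.1, t₁), h1, rfl⟩

lemma VerticallyFillable.verticalHull_union_subset (hΩ : VerticallyFillable Ω) (hΩo : IsOpen Ω)
    (hO : IsOpen O) (hB : IsOpen B) (hOc : VerticallyConvex O) (hBc : VerticallyConvex B)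
    (hOΩ : O ⊆ Ω) (hBΩ : B ⊆ Ω) (hOp : IsPreconnected (Prod.fst '' O))
    (hBp : IsPreconnected (Prod.fst '' B)) (h0 : (O ∩ B).Nonempty) :
    verticalHull (O ∪ B) ⊆ Ω := by
  obtain ⟨⟨x₀, t₀⟩, h0⟩ := h0
  have key : ∀ x t₁ t₂, (x, t₁) ∈ O → (x, t₂) ∈ B → ∀ t ∈ Set.uIcc t₁ t₂, (x, t) ∈ Ω := by
    intro x t₁ t₂ h1 h2
    have hJ := hOp.ordConnected.inter hBp.ordConnected
    have hx₀ : x₀ ∈ Prod.fst '' O ∩ Prod.fst '' B := ⟨⟨_, h0.1, rfl⟩, ⟨_, h0.2, rfl⟩⟩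
    have hx : x ∈ Prod.fst '' O ∩ Prod.fst '' B := ⟨⟨_, h1, rfl⟩, ⟨_, h2, rfl⟩⟩
    rcases le_total x₀ x with h | h
    · have := hΩ.propagate hΩo hO hB hOc hBc hOΩ hBΩ (x₀ := x₀) (τ := 1) (R := x - x₀)
        (by norm_num) ⟨t₀, h0⟩ (fun r hr => hJ.out hx₀ hx ⟨by linarith [hr.1], by linarith [hr.2]⟩)
        (x - x₀) ⟨by linarith, le_rfl⟩ t₁ t₂
      rw [show x₀ + 1 * (x - x₀) = x by ring] at this
      exact this h1 h2
    · have := hΩ.propagate hΩo hO hB hOc hBc hOΩ hBΩ (x₀ := x₀) (τ := -1) (R := x₀ - x)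
        (by norm_num) ⟨t₀, h0⟩ (fun r hr => hJ.out hx hx₀ ⟨by linarith [hr.2], by linarith [hr.1]⟩)
        (x₀ - x) ⟨by linarith, le_rfl⟩ t₁ t₂
      rw [show x₀ + -1 * (x₀ - x) = x by ring] at this
      exact this h1 h2
  rintro ⟨x, t⟩ ⟨t₁, t₂, h1 | h1, h2 | h2, ht⟩
  · exact hOΩ (hOc x t₁ t₂ h1 h2 t ht)
  · exact key x t₁ t₂ h1 h2 t (Set.Icc_subset_uIcc ht)
  · exact key x t₂ t₁ h2 h1 t (Set.Icc_subset_uIcc' ht)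
  · exact hBΩ (hBc x t₁ t₂ h1 h2 t ht)

/-- A planar domain with the one-sided filling property has convex vertical slices. -/
lemma VerticallyFillable.verticallyConvex (hΩ : VerticallyFillable Ω) (hΩo : IsOpen Ω)
    (hΩc : IsPreconnected Ω) : VerticallyConvex Ω := by
  intro x t₁ t₂ h1 h2
  set U : Set (ℝ × ℝ) := ⋃₀ {O | IsOpen O ∧ VerticallyConvex O ∧ O ⊆ Ω ∧
    IsPreconnected (Prod.fst '' O) ∧ (x, t₁) ∈ O} with hU
  have hball : ∀ q ∈ Ω, ∃ B : Set (ℝ × ℝ), IsOpen B ∧ VerticallyConvex B ∧ B ⊆ Ω ∧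
      IsPreconnected (Prod.fst '' B) ∧ q ∈ B := by
    intro q hq
    obtain ⟨r, hr, hs⟩ := Metric.isOpen_iff.1 hΩo q hq
    refine ⟨ball q r, isOpen_ball, ?_, hs, ?_, mem_ball_self hr⟩
    · intro y a b ha hb t ht
      rw [← Prod.mk.eta (p := q), ← ball_prod_same, Set.mem_prod] at *
      refine ⟨ha.1, ?_⟩
      have := (convex_ball q.2 r).ordConnected
      exact this.out ha.2 hb.2 ht
    · exact ((convex_ball q r).isPreconnected).image _ continuousOn_fst
  have hUo : IsOpen U := isOpen_sUnion fun O hO => hO.1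
  have hsub : Ω ⊆ U := by
    refine hΩc.subset_of_closure_inter_subset hUo ⟨(x, t₁), h1, ?_⟩ ?_
    · obtain ⟨B, b1, b2, b3, b4, b5⟩ := hball _ h1
      exact ⟨B, ⟨b1, b2, b3, b4, b5⟩, b5⟩
    · rintro q ⟨hq, hqΩ⟩
      obtain ⟨B, b1, b2, b3, b4, b5⟩ := hball _ hqΩ
      obtain ⟨q', hq'B, O, ⟨o1, o2, o3, o4, o5⟩, hq'O⟩ :=
        mem_closure_iff_nhds.1 hq _ (b1.mem_nhds b5)
      refine ⟨verticalHull (O ∪ B), ⟨isOpen_verticalHull (o1.union b1),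
        verticallyConvex_verticalHull, ?_, ?_, subset_verticalHull (Or.inl o5)⟩,
        subset_verticalHull (Or.inr b5)⟩
      · exact hΩ.verticalHull_union_subset hΩo o1 b1 o2 b2 o3 b3 o4 b4 ⟨q', hq'O, hq'B⟩
      · rw [image_fst_verticalHull, Set.image_union]
        exact o4.union q'.1 ⟨q', hq'O, rfl⟩ ⟨q', hq'B, rfl⟩ b4
  obtain ⟨O, ⟨o1, o2, o3, o4, o5⟩, o6⟩ := hsub h2
  exact fun t ht => o3 (o2 x t₁ t₂ o5 o6 t ht)

end Slices

section ShearedDomain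

/-- The coordinates `(x, σ) ↦ (x, σ - ℓ(x - x₀))` adapted to the grim reaper foliation. -/
def grimShear (c x₀ : ℝ) (q : ℝ × ℝ) : ℝ × ℝ := (q.1, q.2 - reaper c (q.1 - x₀))

/-- The part of a planar domain over a strip, in coordinates adapted to the grim reaper
foliation. -/
def shearedDomain (c x₀ : ℝ) (Ω : Set (ℝ × ℝ)) : Set (ℝ × ℝ) :=
  {q | |q.1 - x₀| < 1} ∩ grimShear c x₀ ⁻¹' Ω

variable {Ω : Set (ℝ × ℝ)} {u : ℝ × ℝ → ℝ} {c s x₀ : ℝ}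

lemma isOpen_strip : IsOpen {q : ℝ × ℝ | |q.1 - x₀| < 1} :=
  isOpen_lt (by fun_prop) continuous_const

lemma contDiffOn_reaper (hc : |c| ≤ 1) :
    ContDiffOn ℝ (⊤ : ℕ∞) (fun x => reaper c (x - x₀)) {x | |x - x₀| < 1} := by
  intro x hx
  have h := half_le_cos_of_abs_lt_one (abs_mul_lt_one hc hx)
  have hne : cos (c * (x - x₀)) ≠ 0 := by linarith
  have h1 : ContDiffAt ℝ (⊤ : ℕ∞) (fun x => cos (c * (x - x₀))) x := by fun_prop
  exact ((h1.log hne).div_const c).contDiffWithinAt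

lemma contDiffOn_grimShear (hc : |c| ≤ 1) :
    ContDiffOn ℝ (⊤ : ℕ∞) (grimShear c x₀) {q : ℝ × ℝ | |q.1 - x₀| < 1} := by
  refine contDiff_fst.contDiffOn.prodMk (contDiff_snd.contDiffOn.sub ?_)
  exact (contDiffOn_reaper hc).comp contDiff_fst.contDiffOn fun q hq => hq

lemma PlanarTranslator.isOpen_shearedDomain (h : PlanarTranslator c s Ω u) :
    IsOpen (shearedDomain c x₀ Ω) :=
  (contDiffOn_grimShear h.abs_c).continuousOn.isOpen_inter_preimage isOpen_strip h.isOpen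

lemma PlanarTranslator.verticallyConvex (h : PlanarTranslator c s Ω u) : VerticallyConvex Ω :=
  VerticallyFillable.verticallyConvex (fun _ _ _ _ _ h1 h2 h3 h4 h5 => h.fill_vertical h1 h2 h3 h4 h5)
    h.isOpen h.isPreconnected

lemma PlanarTranslator.verticallyConvex_shearedDomain (h : PlanarTranslator c s Ω u) :
    VerticallyConvex (shearedDomain c x₀ Ω) := by
  rintro x t₁ t₂ ⟨h1, h1'⟩ ⟨-, h2⟩ t ht
  exact ⟨h1, h.verticallyConvex _ _ _ h1' h2 _ ⟨by linarith [ht.1], by linarith [ht.2]⟩⟩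

lemma PlanarTranslator.isPreconnected_shearedDomain (h : PlanarTranslator c s Ω u) :
    IsPreconnected (shearedDomain c x₀ Ω) := by
  refine isPreconnected_of_verticallyConvex h.isOpen_shearedDomain
    h.verticallyConvex_shearedDomain ?_
  have e : Prod.fst '' shearedDomain c x₀ Ω = {x | |x - x₀| < 1} ∩ Prod.fst '' Ω := by
    ext x
    constructor
    · rintro ⟨q, hq, rfl⟩
      exact ⟨hq.1, grimShear c x₀ q, hq.2, rfl⟩
    · rintro ⟨hx, q, hq, rfl⟩
      exact ⟨(q.1, q.2 + reaper c (q.1 - x₀)), ⟨hx, by simpa [grimShear] using hq⟩, rfl⟩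
  rw [e]
  have e2 : {x | |x - x₀| < 1} = ball x₀ 1 := by ext; simp [Real.dist_eq]
  rw [e2]
  have h1 := (convex_ball x₀ (1 : ℝ)).ordConnected
  have h2 := (h.isPreconnected.image _ continuousOn_fst).ordConnected
  exact (h1.inter h2).isPreconnected

lemma PlanarTranslator.verticallyConvex_swap_shearedDomain (h : PlanarTranslator c s Ω u) :
    VerticallyConvex (Prod.swap ⁻¹' shearedDomain c x₀ Ω) := by
  refine VerticallyFillable.verticallyConvex ?_ (h.isOpen_shearedDomain.preimage continuous_swap) ?_
  · intro τ ε σ₀ x₁ x₂ hτ hε h1 h2 hf x hx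
    have hd : ∀ x ∈ Set.Icc x₁ x₂, |x - x₀| < 1 := by
      intro x hx
      have e1 := abs_lt.1 (show |x₁ - x₀| < 1 from h1.1)
      have e2 := abs_lt.1 (show |x₂ - x₀| < 1 from h2.1)
      exact abs_lt.2 ⟨by linarith [hx.1], by linarith [hx.2]⟩
    refine ⟨hd x hx, ?_⟩
    refine h.fill_grim (l := fun x => reaper c (x - x₀)) (l' := fun x => -tan (c * (x - x₀)))
      (τ := τ) (ε := ε) hτ hε ?_ ?_ ?_ h1.2 h2.2 (fun r hr x hx => (hf r hr x hx).2) x hx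
    · intro x hx
      exact (hasDerivAt_reaper h.abs_c (hd x hx)).comp_sub_const x x₀
    · intro x hx
      exact (hasDerivAt_neg_tan_mul h.abs_c (hd x hx)).comp_sub_const x x₀
    · intro x hx
      exact abs_tan_mul_le_two h.abs_c (hd x hx)
  · rw [← Set.image_swap_eq_preimage_swap]
    exact h.isPreconnected_shearedDomain.image _ continuous_swap.continuousOn

end ShearedDomain

section Divergence

variable {D U V : Set (ℝ × ℝ)} {X Y : ℝ × ℝ → ℝ} {a₁ b₁ a₂ b₂ A ε : ℝ}

lemma integrableOn_of_smooth (hD : IsCompact D) (hDU : D ⊆ U)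
    (hY : ContDiffOn ℝ (⊤ : ℕ∞) Y U) : IntegrableOn Y D :=
  (hY.continuousOn.mono hDU).integrableOn_compact hD

/-- One half of the divergence theorem on a region with convex slices, as an estimate. -/
lemma abs_integral_pdt_le (hD : IsCompact D) (hDc : VerticallyConvex D)
    (hbox : D ⊆ Set.Icc a₁ b₁ ×ˢ Set.Icc a₂ b₂) (hab : a₁ ≤ b₁) (hU : IsOpen U) (hDU : D ⊆ U)
    (hY : ContDiffOn ℝ (⊤ : ℕ∞) Y U) (hA : ∀ q ∈ D, |Y q| ≤ A) (hA0 : 0 ≤ A) :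
    |∫ q in D, pdt Y q| ≤ 2 * A * (b₁ - a₁) := by
  have hYt := contDiffOn_pdt hU hY
  have hInt : Integrable (D.indicator (pdt Y)) :=
    (integrable_indicator_iff hD.measurableSet).2 (integrableOn_of_smooth hD hDU hYt)
  rw [← integral_indicator hD.measurableSet, Measure.volume_eq_prod,
    integral_prod _ (by rwa [← Measure.volume_eq_prod])]
  have hinner : ∀ x, ‖∫ t, D.indicator (pdt Y) (x, t)‖
      ≤ (Set.Icc a₁ b₁).indicator (fun _ => 2 * A) x := by
    intro x
    have hcx : Continuous fun t : ℝ => (x, t) := by fun_prop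
    set Dx : Set ℝ := {t | (x, t) ∈ D} with hDx
    have hDxc : IsCompact Dx := by
      refine isCompact_Icc.of_isClosed_subset (hD.isClosed.preimage hcx)
        (fun t ht => (hbox ht).2 : Dx ⊆ Set.Icc a₂ b₂)
    have e1 : ∫ t, D.indicator (pdt Y) (x, t) = ∫ t in Dx, pdt Y (x, t) := by
      rw [← integral_indicator hDxc.measurableSet]
      rfl
    rw [e1]
    rcases Dx.eq_empty_or_nonempty with h0 | h0
    · rw [h0]
      simp only [Measure.restrict_empty, integral_zero_measure, norm_zero]
      exact Set.indicator_nonneg (fun _ _ => by positivity) x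
    obtain ⟨m, hm⟩ := hDxc.exists_isLeast h0
    obtain ⟨M, hM⟩ := hDxc.exists_isGreatest h0
    have hIcc : Dx = Set.Icc m M :=
      Set.Subset.antisymm (fun t ht => ⟨hm.2 ht, hM.2 ht⟩) (hDc x m M hm.1 hM.1)
    have hmM : m ≤ M := hm.2 hM.1
    have hx : x ∈ Set.Icc a₁ b₁ := (hbox hm.1).1
    rw [Set.indicator_of_mem hx, hIcc, integral_Icc_eq_integral_Ioc,
      ← intervalIntegral.integral_of_le hmM]
    have hmem : ∀ t ∈ Set.uIcc m M, (x, t) ∈ U := by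
      intro t ht
      rw [Set.uIcc_of_le hmM, ← hIcc] at ht
      exact hDU ht
    have hder : ∀ t ∈ Set.uIcc m M, HasDerivAt (fun t => Y (x, t)) (pdt Y (x, t)) t := by
      intro t ht
      have := hasDerivAt_line (p := (x, t)) (differentiableAt_of_smooth hU hY (hmem t ht)) (x, 0) (0, 1) t
        (by ext <;> simp)
      simpa using this
    have hci : IntervalIntegrable (fun t => pdt Y (x, t)) volume m M :=
      (hYt.continuousOn.comp hcx.continuousOn hmem).intervalIntegrable
    rw [intervalIntegral.integral_eq_sub_of_hasDerivAt hder hci]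
    have h1 := abs_le.1 (hA _ hm.1)
    have h2 := abs_le.1 (hA _ hM.1)
    exact abs_le.2 ⟨by linarith, by linarith⟩
  have hgi : Integrable ((Set.Icc a₁ b₁).indicator (fun _ => 2 * A)) :=
    (integrable_indicator_iff measurableSet_Icc).2 continuousOn_const.integrableOn_Icc
  have := norm_integral_le_of_norm_le hgi (Filter.Eventually.of_forall hinner)
  rw [integral_indicator measurableSet_Icc] at this
  simp only [integral_const, smul_eq_mul, MeasurableSet.univ, measureReal_restrict_apply,
    Set.univ_inter, volume_real_Icc_of_le hab] at this
  rw [norm_eq_abs] at this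
  linarith

lemma pdt_comp_swap (X : ℝ × ℝ → ℝ) (p : ℝ × ℝ) : pdt (X ∘ Prod.swap) p = pds X p.swap := by
  have := (ContinuousLinearEquiv.prodComm ℝ ℝ ℝ).comp_right_fderiv (f := X) (x := p)
  have h2 := congrArg (fun L : (ℝ × ℝ) →L[ℝ] ℝ => L (0, 1)) this
  exact h2

/-- The other half of the divergence theorem on a region with convex slices, as an estimate. -/
lemma abs_integral_pds_le (hD : IsCompact D) (hDc : VerticallyConvex (Prod.swap ⁻¹' D))
    (hbox : D ⊆ Set.Icc a₁ b₁ ×ˢ Set.Icc a₂ b₂) (hab : a₂ ≤ b₂) (hU : IsOpen U) (hDU : D ⊆ U)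
    (hX : ContDiffOn ℝ (⊤ : ℕ∞) X U) (hA : ∀ q ∈ D, |X q| ≤ A) (hA0 : 0 ≤ A) :
    |∫ q in D, pds X q| ≤ 2 * A * (b₂ - a₂) := by
  have h := abs_integral_pdt_le (D := Prod.swap ⁻¹' D) (U := Prod.swap ⁻¹' U)
    (Y := X ∘ Prod.swap) (a₁ := a₂) (b₁ := b₂) (a₂ := a₁) (b₂ := b₁) (A := A)
    ((Homeomorph.prodComm ℝ ℝ).isCompact_preimage.2 hD) hDc
    (fun q hq => ⟨(hbox hq).2, (hbox hq).1⟩) hab (hU.preimage continuous_swap)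
    (fun q hq => hDU hq)
    (hX.comp (ContinuousLinearEquiv.prodComm ℝ ℝ ℝ).contDiff.contDiffOn fun q hq => hq)
    (fun q hq => hA _ hq) hA0
  simp only [pdt_comp_swap] at h
  have hm : MeasurePreserving (Prod.swap : ℝ × ℝ → ℝ × ℝ) volume volume :=
    Measure.measurePreserving_swap
  rwa [hm.setIntegral_preimage_emb (MeasurableEquiv.prodComm).measurableEmbedding (pds X) D] at h

/-- The points of `V` at distance at least `ε` from the complement, for the sup norm. -/
def erosion (ε : ℝ) (V : Set (ℝ × ℝ)) : Set (ℝ × ℝ) := {p | ball p ε ⊆ V}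

lemma isClosed_erosion : IsClosed (erosion ε V) := by
  refine isClosed_of_closure_subset fun p hp y hy => ?_
  have : ∀ᶠ q in nhds p, dist y q < ε :=
    (continuous_const.dist continuous_id).continuousAt.eventually_lt_const hy
  obtain ⟨q, hq, hq'⟩ := mem_closure_iff_nhds.1 hp _ this
  exact hq' hq

lemma erosion_subset (hε : 0 < ε) : erosion ε V ⊆ V := fun _ hp => hp (mem_ball_self hε)

lemma VerticallyConvex.erosion (hV : VerticallyConvex V) : VerticallyConvex (erosion ε V) := by
  rintro x t₁ t₂ h1 h2 t ht ⟨y₁, y₂⟩ hy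
  rw [← ball_prod_same, Set.mem_prod, mem_ball, mem_ball, Real.dist_eq, Real.dist_eq] at hy
  have e1 : (y₁, t₁ + (y₂ - t)) ∈ V := h1 (by
    rw [← ball_prod_same, Set.mem_prod, mem_ball, mem_ball, Real.dist_eq, Real.dist_eq]
    exact ⟨hy.1, by simpa using hy.2⟩)
  have e2 : (y₁, t₂ + (y₂ - t)) ∈ V := h2 (by
    rw [← ball_prod_same, Set.mem_prod, mem_ball, mem_ball, Real.dist_eq, Real.dist_eq]
    exact ⟨hy.1, by simpa using hy.2⟩)
  exact hV _ _ _ e1 e2 _ ⟨by linarith [ht.1], by linarith [ht.2]⟩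

lemma preimage_swap_erosion :
    Prod.swap ⁻¹' erosion ε V = erosion ε (Prod.swap ⁻¹' V) := by
  ext p
  constructor
  · intro h q hq
    refine h ?_
    simpa [Prod.dist_eq, max_comm] using hq
  · intro h q hq
    have : q.swap ∈ ball p ε := by simpa [Prod.dist_eq, max_comm, and_comm] using hq
    simpa using h this

end Divergence

section Energy

/-- The area density of the graph of `u`. -/
def areaDensity (u : ℝ × ℝ → ℝ) (q : ℝ × ℝ) : ℝ := √(1 + pds u q ^ 2 + pdt u q ^ 2)

variable {Ω D : Set (ℝ × ℝ)} {u f : ℝ × ℝ → ℝ} {p : ℝ × ℝ} {c s x₀ d z : ℝ}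

lemma one_le_areaDensity (u : ℝ × ℝ → ℝ) (q : ℝ × ℝ) : 1 ≤ areaDensity u q :=
  one_le_sqrt.2 (by nlinarith [sq_nonneg (pds u q), sq_nonneg (pdt u q)])

lemma sq_areaDensity (u : ℝ × ℝ → ℝ) (q : ℝ × ℝ) :
    areaDensity u q ^ 2 = 1 + pds u q ^ 2 + pdt u q ^ 2 := sq_sqrt (by positivity)

lemma abs_pds_le_areaDensity (u : ℝ × ℝ → ℝ) (q : ℝ × ℝ) : |pds u q| ≤ areaDensity u q :=
  abs_le_sqrt (by nlinarith [sq_nonneg (pdt u q)])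

lemma abs_pdt_le_areaDensity (u : ℝ × ℝ → ℝ) (q : ℝ × ℝ) : |pdt u q| ≤ areaDensity u q :=
  abs_le_sqrt (by nlinarith [sq_nonneg (pds u q)])

lemma contDiffOn_areaDensity (hΩ : IsOpen Ω) (hu : ContDiffOn ℝ (⊤ : ℕ∞) u Ω) :
    ContDiffOn ℝ (⊤ : ℕ∞) (areaDensity u) Ω :=
  ((contDiffOn_const.add ((contDiffOn_pds hΩ hu).pow 2)).add
    ((contDiffOn_pdt hΩ hu).pow 2)).sqrt fun q _ => by positivity

lemma pds_eq_of_hasDerivAt (hf : DifferentiableAt ℝ f p)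
    (h : HasDerivAt (fun r : ℝ => f (p + r • (1, 0))) d 0) : pds f p = d := by
  have := hasDerivAt_line hf p (1, 0) 0 (by simp)
  simpa using this.unique h

lemma pdt_eq_of_hasDerivAt (hf : DifferentiableAt ℝ f p)
    (h : HasDerivAt (fun r : ℝ => f (p + r • (0, 1))) d 0) : pdt f p = d := by
  have := hasDerivAt_line hf p (0, 1) 0 (by simp)
  simpa using this.unique h

/-- The first component of the calibrating vector field. -/
def fieldFst (z : ℝ) (u : ℝ × ℝ → ℝ) (q : ℝ × ℝ) : ℝ :=
  arctan (u q - z) * (pds u q / areaDensity u q)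

/-- The second component of the calibrating vector field. -/
def fieldSnd (z : ℝ) (u : ℝ × ℝ → ℝ) (q : ℝ × ℝ) : ℝ :=
  arctan (u q - z) * (pdt u q / areaDensity u q)

lemma contDiffOn_fieldFst (hΩ : IsOpen Ω) (hu : ContDiffOn ℝ (⊤ : ℕ∞) u Ω) :
    ContDiffOn ℝ (⊤ : ℕ∞) (fieldFst z u) Ω :=
  (contDiff_arctan.comp_contDiffOn (hu.sub contDiffOn_const)).mul
    ((contDiffOn_pds hΩ hu).div (contDiffOn_areaDensity hΩ hu)
      fun q _ => (zero_lt_one.trans_le (one_le_areaDensity u q)).ne')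

lemma contDiffOn_fieldSnd (hΩ : IsOpen Ω) (hu : ContDiffOn ℝ (⊤ : ℕ∞) u Ω) :
    ContDiffOn ℝ (⊤ : ℕ∞) (fieldSnd z u) Ω :=
  (contDiff_arctan.comp_contDiffOn (hu.sub contDiffOn_const)).mul
    ((contDiffOn_pdt hΩ hu).div (contDiffOn_areaDensity hΩ hu)
      fun q _ => (zero_lt_one.trans_le (one_le_areaDensity u q)).ne')

lemma hasDerivAt_arctan_mul_div {a b e : ℝ → ℝ} {a' b' e' r : ℝ} (ha : HasDerivAt a a' r)
    (hb : HasDerivAt b b' r) (he : HasDerivAt e e' r) (z : ℝ) :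
    HasDerivAt (fun r => arctan (a r - z) * (b r / √(1 + b r ^ 2 + e r ^ 2)))
      (a' / (1 + (a r - z) ^ 2) * (b r / √(1 + b r ^ 2 + e r ^ 2))
        + arctan (a r - z) * (((1 + e r ^ 2) * b' - b r * e r * e')
          / √(1 + b r ^ 2 + e r ^ 2) ^ 3)) r := by
  have hpos : 0 < 1 + b r ^ 2 + e r ^ 2 := by positivity
  have h1 := (ha.sub_const z).arctan
  have h2 := ((((hb.pow 2).const_add 1).add (he.pow 2)).sqrt hpos.ne')
  have hs : 0 < √(1 + b r ^ 2 + e r ^ 2) := sqrt_pos.2 hpos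
  have hsq : √(1 + b r ^ 2 + e r ^ 2) ^ 2 = 1 + b r ^ 2 + e r ^ 2 := sq_sqrt hpos.le
  refine (h1.mul (hb.div h2 hs.ne')).congr_deriv ?_
  simp only [Pi.add_apply, Pi.pow_apply, Pi.div_apply] at *
  set w := √(1 + b r ^ 2 + e r ^ 2) with hw
  have e1 : (b' * w - b r * ((↑(2 : ℕ) * b r ^ (2 - 1) * b' + ↑(2 : ℕ) * e r ^ (2 - 1) * e')
      / (2 * w))) / w ^ 2 = ((1 + e r ^ 2) * b' - b r * e r * e') / w ^ 3 := by
    field_simp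
    push_cast
    rw [hsq]
    ring
  rw [← e1]
  ring

lemma PlanarTranslator.div_field (h : PlanarTranslator c s Ω u) (hp : p ∈ Ω) :
    pds (fieldFst z u) p + pdt (fieldSnd z u) p
      = (pds u p ^ 2 + pdt u p ^ 2) / areaDensity u p / (1 + (u p - z) ^ 2)
        + arctan (u p - z) * ((s - pdt u p * c) / areaDensity u p) := by
  have hu := differentiableAt_of_smooth h.isOpen h.smooth hp
  have hus := differentiableAt_of_smooth h.isOpen (contDiffOn_pds h.isOpen h.smooth) hp
  have hut := differentiableAt_of_smooth h.isOpen (contDiffOn_pdt h.isOpen h.smooth) hp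
  have hF := differentiableAt_of_smooth h.isOpen (contDiffOn_fieldFst (z := z) h.isOpen h.smooth) hp
  have hG := differentiableAt_of_smooth h.isOpen (contDiffOn_fieldSnd (z := z) h.isOpen h.smooth) hp
  have e1 := hasDerivAt_arctan_mul_div (hasDerivAt_line hu p (1, 0) 0 (by simp))
    (hasDerivAt_line hus p (1, 0) 0 (by simp)) (hasDerivAt_line hut p (1, 0) 0 (by simp)) z
  have e2 := hasDerivAt_arctan_mul_div (hasDerivAt_line hu p (0, 1) 0 (by simp))
    (hasDerivAt_line hut p (0, 1) 0 (by simp)) (hasDerivAt_line hus p (0, 1) 0 (by simp)) z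
  simp only [add_right_comm (1 : ℝ) (pdt u _ ^ 2)] at e2
  rw [pds_eq_of_hasDerivAt hF e1, pdt_eq_of_hasDerivAt hG e2]
  have hpde := h.pde p hp
  change (1 + (pdt u p) ^ 2) * pds (pds u) p
      - 2 * pds u p * pdt u p * pdt (pds u) p
      + (1 + (pds u p) ^ 2) * pdt (pdt u) p
    = (1 + (pds u p) ^ 2 + (pdt u p) ^ 2) * (s - pdt u p * c) at hpde
  have hsq := sq_areaDensity u p
  have hW := one_le_areaDensity u p
  have hcomm := pds_pdt_comm h.isOpen h.smooth hp
  simp only [zero_smul, add_zero, one_mul, zero_mul, zero_add, hcomm]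
  change _ / _ * (pds u p / areaDensity u p) + _ * (_ / areaDensity u p ^ 3)
    + (_ / _ * (pdt u p / areaDensity u p) + _ * (_ / areaDensity u p ^ 3)) = _
  have hy : 0 < 1 + (u p - z) ^ 2 := by positivity
  have e3 : (s - pdt u p * c) / areaDensity u p
      = ((1 + (pdt u p) ^ 2) * pds (pds u) p
      - 2 * pds u p * pdt u p * pdt (pds u) p
      + (1 + (pds u p) ^ 2) * pdt (pdt u) p) / areaDensity u p ^ 3 := by
    rw [hpde, ← hsq]; field_simp
  rw [e3]
  ring

lemma contDiffOn_comp_grimShear (hc : |c| ≤ 1) (hf : ContDiffOn ℝ (⊤ : ℕ∞) f Ω) :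
    ContDiffOn ℝ (⊤ : ℕ∞) (fun q => f (grimShear c x₀ q)) (shearedDomain c x₀ Ω) :=
  hf.comp ((contDiffOn_grimShear hc).mono Set.inter_subset_left) fun _ hq => hq.2

lemma contDiffOn_neg_tan (hc : |c| ≤ 1) :
    ContDiffOn ℝ (⊤ : ℕ∞) (fun q : ℝ × ℝ => -tan (c * (q.1 - x₀))) (shearedDomain c x₀ Ω) := by
  intro q hq
  have h := half_le_cos_of_abs_lt_one (abs_mul_lt_one hc hq.1)
  have hne : cos (c * (q.1 - x₀)) ≠ 0 := by linarith
  have h1 : ContDiffAt ℝ (⊤ : ℕ∞) (fun q : ℝ × ℝ => c * (q.1 - x₀)) q := by fun_prop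
  exact ((contDiffAt_tan.2 hne).comp q h1).neg.contDiffWithinAt

/-- The divergence of a field is unchanged in coordinates adapted to the grim reaper foliation. -/
lemma div_sheared (hc : |c| ≤ 1) {X Y : ℝ × ℝ → ℝ} (hX : DifferentiableAt ℝ X (grimShear c x₀ p))
    (hY : DifferentiableAt ℝ Y (grimShear c x₀ p)) (hp : |p.1 - x₀| < 1)
    (h1 : DifferentiableAt ℝ (fun q => X (grimShear c x₀ q)) p)
    (h2 : DifferentiableAt ℝ (fun q => Y (grimShear c x₀ q)
        + -tan (c * (q.1 - x₀)) * X (grimShear c x₀ q)) p) :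
    pds (fun q => X (grimShear c x₀ q)) p
      + pdt (fun q => Y (grimShear c x₀ q)
        + -tan (c * (q.1 - x₀)) * X (grimShear c x₀ q)) p
      = pds X (grimShear c x₀ p) + pdt Y (grimShear c x₀ p) := by
  have g1 : HasDerivAt (fun r : ℝ => grimShear c x₀ (p + r • (1, 0)))
      (1, - -tan (c * (p.1 - x₀))) 0 := by
    have a1 : HasDerivAt (fun r : ℝ => p.1 + r) 1 0 := by
      simpa using (hasDerivAt_id (0 : ℝ)).const_add p.1
    have a2 : HasDerivAt (fun r : ℝ => p.1 + r - x₀) 1 0 := a1.sub_const x₀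
    have a3 : HasDerivAt (reaper c) (-tan (c * (p.1 - x₀))) (p.1 + 0 - x₀) := by
      rw [add_zero]; exact hasDerivAt_reaper hc hp
    have a4 := (a3.comp (0 : ℝ) a2).const_sub p.2
    have := a1.prodMk a4
    simpa [grimShear, Function.comp_def] using this
  have g2 : HasDerivAt (fun r : ℝ => grimShear c x₀ (p + r • (0, 1))) (0, 1) 0 := by
    have a1 : HasDerivAt (fun r : ℝ => p.2 + r - reaper c (p.1 - x₀)) 1 0 := by
      simpa using ((hasDerivAt_id (0 : ℝ)).const_add p.2).sub_const (reaper c (p.1 - x₀))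
    have := (hasDerivAt_const (0 : ℝ) p.1).prodMk a1
    simpa [grimShear] using this
  have z1 : grimShear c x₀ (p + (0 : ℝ) • (1, 0)) = grimShear c x₀ p := by simp
  have z2 : grimShear c x₀ (p + (0 : ℝ) • (0, 1)) = grimShear c x₀ p := by simp
  have d1 := (z1.symm ▸ hX.hasFDerivAt : HasFDerivAt X _ _).comp_hasDerivAt (0 : ℝ) g1
  have d2 := (z2.symm ▸ hX.hasFDerivAt : HasFDerivAt X _ _).comp_hasDerivAt (0 : ℝ) g2
  have d3 := (z2.symm ▸ hY.hasFDerivAt : HasFDerivAt Y _ _).comp_hasDerivAt (0 : ℝ) g2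
  rw [pds_eq_of_hasDerivAt h1 d1, pdt_eq_of_hasDerivAt h2
    ((d3.add (d2.const_mul (-tan (c * (p.1 - x₀))))).congr_of_eventuallyEq
      (Filter.Eventually.of_forall fun r => by simp))]
  rw [z1, z2]
  simp only [fderiv_apply_eq_partials]
  ring

lemma abs_arctan_le_two (x : ℝ) : |arctan x| ≤ 2 := by
  have h1 := arctan_lt_pi_div_two x
  have h2 := neg_pi_div_two_lt_arctan x
  have h3 := pi_le_four
  exact abs_le.2 ⟨by linarith, by linarith⟩

lemma abs_fieldFst_le (z : ℝ) (u : ℝ × ℝ → ℝ) (q : ℝ × ℝ) : |fieldFst z u q| ≤ 2 := by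
  have h1 : |pds u q / areaDensity u q| ≤ 1 := by
    rw [abs_div, abs_of_pos (zero_lt_one.trans_le (one_le_areaDensity u q))]
    exact div_le_one_of_le₀ (abs_pds_le_areaDensity u q)
      (zero_le_one.trans (one_le_areaDensity u q))
  rw [fieldFst, abs_mul]
  nlinarith [abs_arctan_le_two (u q - z), abs_nonneg (arctan (u q - z))]

lemma abs_fieldSnd_le (z : ℝ) (u : ℝ × ℝ → ℝ) (q : ℝ × ℝ) : |fieldSnd z u q| ≤ 2 := by
  have h1 : |pdt u q / areaDensity u q| ≤ 1 := by
    rw [abs_div, abs_of_pos (zero_lt_one.trans_le (one_le_areaDensity u q))]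
    exact div_le_one_of_le₀ (abs_pdt_le_areaDensity u q)
      (zero_le_one.trans (one_le_areaDensity u q))
  rw [fieldSnd, abs_mul]
  nlinarith [abs_arctan_le_two (u q - z), abs_nonneg (arctan (u q - z))]

lemma PlanarTranslator.areaDensity_div_le (h : PlanarTranslator c s Ω u) (hp : p ∈ Ω) (z : ℝ) :
    areaDensity u p / (1 + (u p - z) ^ 2)
      ≤ 5 + (pds (fieldFst z u) p + pdt (fieldSnd z u) p) := by
  rw [h.div_field hp]
  have hW := one_le_areaDensity u p
  have hsq := sq_areaDensity u p
  have ht := abs_pdt_le_areaDensity u p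
  set W := areaDensity u p with hWd
  have hW0 : 0 < W := by linarith
  have hy : 1 ≤ 1 + (u p - z) ^ 2 := by nlinarith [sq_nonneg (u p - z)]
  have e1 : (pds u p ^ 2 + pdt u p ^ 2) / W / (1 + (u p - z) ^ 2)
      = W / (1 + (u p - z) ^ 2) - 1 / (W * (1 + (u p - z) ^ 2)) := by
    have : pds u p ^ 2 + pdt u p ^ 2 = W ^ 2 - 1 := by linarith
    rw [this]
    field_simp
  have e2 : 1 / (W * (1 + (u p - z) ^ 2)) ≤ 1 :=
    div_le_one_of_le₀ (one_le_mul_of_one_le_of_one_le hW hy) (by positivity)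
  have e3 : |(s - pdt u p * c) / W| ≤ 2 := by
    rw [abs_div, abs_of_pos hW0, div_le_iff₀ hW0]
    have h1 : |pdt u p * c| ≤ W := by
      rw [abs_mul]; nlinarith [h.abs_c, abs_nonneg (pdt u p), abs_nonneg c]
    linarith [abs_sub s (pdt u p * c), h.abs_s]
  have e4 : |arctan (u p - z) * ((s - pdt u p * c) / W)| ≤ 4 := by
    rw [abs_mul]
    nlinarith [abs_arctan_le_two (u p - z), abs_nonneg (arctan (u p - z)),
      abs_nonneg ((s - pdt u p * c) / W)]
  linarith [(abs_le.1 e4).1]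

/-- The weighted area of a translating graph over a region with convex slices is bounded in terms
of the size of the region only. -/
lemma PlanarTranslator.integral_areaDensity_le (h : PlanarTranslator c s Ω u) (hD : IsCompact D)
    (hDc : VerticallyConvex D) (hDc' : VerticallyConvex (Prod.swap ⁻¹' D))
    (hDΩ : D ⊆ shearedDomain c x₀ Ω) {a l : ℝ} (hl : 0 ≤ l)
    (hbox : D ⊆ Set.Icc (x₀ - 1 / 2) (x₀ + 1 / 2) ×ˢ Set.Icc a (a + l)) (z : ℝ) :
    ∫ q in D, areaDensity u (grimShear c x₀ q) / (1 + (u (grimShear c x₀ q) - z) ^ 2)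
      ≤ 17 * (1 + l) := by
  set X : ℝ × ℝ → ℝ := fun q => fieldFst z u (grimShear c x₀ q) with hXd
  set Y : ℝ × ℝ → ℝ := fun q => fieldSnd z u (grimShear c x₀ q)
        + -tan (c * (q.1 - x₀)) * fieldFst z u (grimShear c x₀ q) with hYd
  have hUo := h.isOpen_shearedDomain (x₀ := x₀)
  have hX : ContDiffOn ℝ (⊤ : ℕ∞) X (shearedDomain c x₀ Ω) :=
    contDiffOn_comp_grimShear h.abs_c (contDiffOn_fieldFst h.isOpen h.smooth)
  have hY : ContDiffOn ℝ (⊤ : ℕ∞) Y (shearedDomain c x₀ Ω) :=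
    (contDiffOn_comp_grimShear h.abs_c (contDiffOn_fieldSnd h.isOpen h.smooth)).add
      ((contDiffOn_neg_tan h.abs_c).mul hX)
  have hXb : ∀ q ∈ D, |X q| ≤ 6 := fun q _ => (abs_fieldFst_le z u _).trans (by norm_num)
  have hYb : ∀ q ∈ D, |Y q| ≤ 6 := by
    intro q hq
    have h1 := abs_fieldFst_le z u (grimShear c x₀ q)
    have h2 := abs_fieldSnd_le z u (grimShear c x₀ q)
    have h3 := abs_tan_mul_le_two h.abs_c (hDΩ hq).1
    refine (abs_add_le _ _).trans ?_
    rw [abs_mul]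
    nlinarith [abs_nonneg (fieldFst z u (grimShear c x₀ q)), abs_nonneg (-tan (c * (q.1 - x₀)))]
  have b1 := abs_integral_pds_le hD hDc' hbox (by linarith) hUo hDΩ hX hXb (by norm_num)
  have b2 := abs_integral_pdt_le hD hDc hbox (by linarith) hUo hDΩ hY hYb (by norm_num)
  have i1 : IntegrableOn (pds X) D := integrableOn_of_smooth hD hDΩ (contDiffOn_pds hUo hX)
  have i2 : IntegrableOn (pdt Y) D := integrableOn_of_smooth hD hDΩ (contDiffOn_pdt hUo hY)
  have i12 : IntegrableOn (fun q => pds X q + pdt Y q) D := i1.add i2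
  have i3 : IntegrableOn (fun _ : ℝ × ℝ => (5 : ℝ)) D :=
    continuousOn_const.integrableOn_compact hD
  have i4 : IntegrableOn (fun q => areaDensity u (grimShear c x₀ q)
      / (1 + (u (grimShear c x₀ q) - z) ^ 2)) D := by
    refine integrableOn_of_smooth hD hDΩ (ContDiffOn.div (contDiffOn_comp_grimShear h.abs_c
      (contDiffOn_areaDensity h.isOpen h.smooth)) (contDiffOn_const.add
      (((contDiffOn_comp_grimShear h.abs_c h.smooth).sub contDiffOn_const).pow 2)) ?_)
    intro q _
    positivity
  have hle : ∀ q ∈ D, areaDensity u (grimShear c x₀ q) / (1 + (u (grimShear c x₀ q) - z) ^ 2)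
      ≤ 5 + (pds X q + pdt Y q) := by
    intro q hq
    have hq' := hDΩ hq
    rw [hXd, hYd, div_sheared h.abs_c
      (differentiableAt_of_smooth h.isOpen (contDiffOn_fieldFst h.isOpen h.smooth) hq'.2)
      (differentiableAt_of_smooth h.isOpen (contDiffOn_fieldSnd h.isOpen h.smooth) hq'.2) hq'.1
      (differentiableAt_of_smooth hUo hX hq') (differentiableAt_of_smooth hUo hY hq')]
    exact h.areaDensity_div_le hq'.2 z
  have hvol : volume.real D ≤ l := by
    have h1 := measureReal_mono (μ := volume) hbox (isCompact_Icc.prod isCompact_Icc).measure_ne_top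
    have h2 : volume.real (Set.Icc (x₀ - 1 / 2) (x₀ + 1 / 2) ×ˢ Set.Icc a (a + l)) = l := by
      rw [Measure.volume_eq_prod, measureReal_prod_prod, volume_real_Icc_of_le (by linarith),
        volume_real_Icc_of_le (by linarith)]
      ring
    linarith
  calc _ ≤ ∫ q in D, (5 + (pds X q + pdt Y q)) :=
        setIntegral_mono_on i4 (i3.add i12) hD.measurableSet hle
    _ = 5 * volume.real D + ((∫ q in D, pds X q) + ∫ q in D, pdt Y q) := by
        rw [integral_add i3 i12, integral_add i1 i2]
        simp [mul_comm]
    _ ≤ _ := by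
        have := (abs_le.1 b1).2
        have := (abs_le.1 b2).2
        linarith

end Energy

section LocalArea

variable {Ω E : Set (ℝ × ℝ)} {u : ℝ × ℝ → ℝ} {c s x₀ : ℝ}

lemma det_prod_clm (A : ℝ × ℝ →L[ℝ] ℝ × ℝ) :
    A.det = (A (1, 0)).1 * (A (0, 1)).2 - (A (0, 1)).1 * (A (1, 0)).2 := by
  rw [ContinuousLinearMap.det, ← LinearMap.det_toMatrix (Module.Basis.finTwoProd ℝ),
    Matrix.det_fin_two]
  simp [LinearMap.toMatrix_apply]

lemma hasFDerivAt_grimShear (hc : |c| ≤ 1) {q : ℝ × ℝ} (hq : |q.1 - x₀| < 1) :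
    HasFDerivAt (grimShear c x₀) ((ContinuousLinearMap.fst ℝ ℝ ℝ).prod
      (ContinuousLinearMap.snd ℝ ℝ ℝ
        - (-tan (c * (q.1 - x₀))) • ContinuousLinearMap.fst ℝ ℝ ℝ)) q := by
  refine hasFDerivAt_fst.prodMk (hasFDerivAt_snd.sub ?_)
  exact (hasDerivAt_reaper hc hq).comp_hasFDerivAt q
    ((hasFDerivAt_fst (𝕜 := ℝ) (p := q)).sub_const x₀)

lemma grimShear_injective : Function.Injective (grimShear c x₀) := by
  rintro ⟨x, t⟩ ⟨x', t'⟩ h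
  simp only [grimShear, Prod.mk.injEq] at h
  obtain ⟨rfl, h⟩ := h
  simpa using h

lemma lintegral_image_grimShear (hc : |c| ≤ 1) {Z : Set (ℝ × ℝ)} (hZ : MeasurableSet Z)
    (hZs : ∀ q ∈ Z, |q.1 - x₀| < 1) (g : ℝ × ℝ → ℝ≥0∞) :
    ∫⁻ p in grimShear c x₀ '' Z, g p = ∫⁻ q in Z, g (grimShear c x₀ q) := by
  rw [lintegral_image_eq_lintegral_abs_det_fderiv_mul volume hZ
    (fun q hq => (hasFDerivAt_grimShear hc (hZs q hq)).hasFDerivWithinAt)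
    grimShear_injective.injOn]
  simp [det_prod_clm]

lemma VerticallyConvex.inter {V V' : Set (ℝ × ℝ)} (h : VerticallyConvex V)
    (h' : VerticallyConvex V') : VerticallyConvex (V ∩ V') :=
  fun x t₁ t₂ h1 h2 t ht => ⟨h x t₁ t₂ h1.1 h2.1 t ht, h' x t₁ t₂ h1.2 h2.2 t ht⟩

lemma verticallyConvex_box (a₁ b₁ a₂ b₂ : ℝ) :
    VerticallyConvex (Set.Icc a₁ b₁ ×ˢ Set.Icc a₂ b₂) :=
  fun _ _ _ h1 h2 _ ht => ⟨h1.1, h1.2.1.trans ht.1, ht.2.trans h2.2.2⟩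

/-- The weighted area over a compact set in sheared coordinates. -/
lemma PlanarTranslator.integral_areaDensity_le_of_isCompact (h : PlanarTranslator c s Ω u)
    {Z : Set (ℝ × ℝ)} (hZ : IsCompact Z) (hZΩ : Z ⊆ shearedDomain c x₀ Ω) {a l : ℝ} (hl : 0 ≤ l)
    (hbox : Z ⊆ Set.Icc (x₀ - 1 / 2) (x₀ + 1 / 2) ×ˢ Set.Icc a (a + l)) (z : ℝ) :
    IntegrableOn (fun q => areaDensity u (grimShear c x₀ q)
      / (1 + (u (grimShear c x₀ q) - z) ^ 2)) Z ∧
    ∫ q in Z, areaDensity u (grimShear c x₀ q) / (1 + (u (grimShear c x₀ q) - z) ^ 2)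
      ≤ 17 * (1 + l) := by
  obtain ⟨ε, hε, hεZ⟩ := hZ.exists_thickening_subset_open h.isOpen_shearedDomain hZΩ
  set B : Set (ℝ × ℝ) := Set.Icc (x₀ - 1 / 2) (x₀ + 1 / 2) ×ˢ Set.Icc a (a + l) with hB
  set D := erosion ε (shearedDomain c x₀ Ω) ∩ B with hDdef
  have hZD : Z ⊆ D := fun p hp => ⟨(ball_subset_thickening hp ε).trans hεZ, hbox hp⟩
  have hD : IsCompact D := (isCompact_Icc.prod isCompact_Icc).inter_left isClosed_erosion
  have hDΩ : D ⊆ shearedDomain c x₀ Ω := Set.inter_subset_left.trans (erosion_subset hε)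
  have hInt : IntegrableOn (fun q => areaDensity u (grimShear c x₀ q)
      / (1 + (u (grimShear c x₀ q) - z) ^ 2)) D := by
    refine integrableOn_of_smooth hD hDΩ (ContDiffOn.div (contDiffOn_comp_grimShear h.abs_c
      (contDiffOn_areaDensity h.isOpen h.smooth)) (contDiffOn_const.add
      (((contDiffOn_comp_grimShear h.abs_c h.smooth).sub contDiffOn_const).pow 2)) ?_)
    intro q _
    positivity
  refine ⟨hInt.mono_set hZD, (setIntegral_mono_set hInt (Filter.Eventually.of_forall fun q => ?_)
    hZD.eventuallyLE).trans (h.integral_areaDensity_le hD ?_ ?_ hDΩ hl Set.inter_subset_right z)⟩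
  · exact div_nonneg (sqrt_nonneg _) (by positivity)
  · exact h.verticallyConvex_shearedDomain.erosion.inter (verticallyConvex_box _ _ _ _)
  · rw [hDdef, Set.preimage_inter, preimage_swap_erosion, hB, Set.preimage_swap_prod]
    exact h.verticallyConvex_swap_shearedDomain.erosion.inter (verticallyConvex_box _ _ _ _)

/-- Area bound over a compact piece of the domain which is bounded in all directions. -/
lemma PlanarTranslator.lintegral_areaDensity_le (h : PlanarTranslator c s Ω u) (hE : IsCompact E)
    (hEΩ : E ⊆ Ω) {a l m z : ℝ} (hl : 0 ≤ l)
    (hbox : E ⊆ Set.Icc (x₀ - 1 / 2) (x₀ + 1 / 2) ×ˢ Set.Icc a (a + l))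
    (hz : ∀ p ∈ E, |u p - z| ≤ m) :
    ∫⁻ p in E, ENNReal.ofReal (areaDensity u p)
      ≤ ENNReal.ofReal ((1 + m ^ 2) * (17 * (3 + l))) := by
  have hstrip : ∀ x ∈ Set.Icc (x₀ - 1 / 2) (x₀ + 1 / 2), |x - x₀| ≤ 1 / 2 := fun x hx =>
    abs_le.2 ⟨by linarith [hx.1], by linarith [hx.2]⟩
  set Z := (fun p : ℝ × ℝ => (p.1, p.2 + reaper c (p.1 - x₀))) '' E with hZdef
  have hZE : ∀ p, grimShear c x₀ (p.1, p.2 + reaper c (p.1 - x₀)) = p := fun p => by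
    simp [grimShear]
  have himg : grimShear c x₀ '' Z = E := by
    rw [hZdef, Set.image_image]; simp [hZE]
  have hZc : IsCompact Z := by
    refine hE.image_of_continuousOn (continuousOn_fst.prodMk (continuousOn_snd.add ?_))
    refine ((contDiffOn_reaper h.abs_c).continuousOn (s := {x | |x - x₀| < 1})).comp
      continuousOn_fst fun p hp => ?_
    exact (hstrip _ (hbox hp).1).trans_lt (by norm_num)
  have hZb : Z ⊆ Set.Icc (x₀ - 1 / 2) (x₀ + 1 / 2) ×ˢ Set.Icc (a - 1) (a - 1 + (l + 2)) := by
    rintro _ ⟨p, hp, rfl⟩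
    have h1 := abs_le.1 (abs_reaper_le_one h.abs_c (hstrip _ (hbox hp).1))
    have h2 := (hbox hp).2
    exact ⟨(hbox hp).1, by linarith [h2.1], by linarith [h2.2]⟩
  have hZs : ∀ q ∈ Z, |q.1 - x₀| < 1 := fun q hq =>
    (hstrip _ (hZb hq).1).trans_lt (by norm_num)
  have hZm : ∀ q ∈ Z, grimShear c x₀ q ∈ E := fun q hq => himg ▸ Set.mem_image_of_mem _ hq
  have hZΩ : Z ⊆ shearedDomain c x₀ Ω := fun q hq => ⟨hZs q hq, hEΩ (hZm q hq)⟩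
  obtain ⟨hInt, hle⟩ := h.integral_areaDensity_le_of_isCompact hZc hZΩ (by linarith) hZb z
  have e : ∫⁻ p in E, ENNReal.ofReal (areaDensity u p)
      = ∫⁻ q in Z, ENNReal.ofReal (areaDensity u (grimShear c x₀ q)) := by
    rw [← lintegral_image_grimShear h.abs_c hZc.measurableSet hZs
      (fun p => ENNReal.ofReal (areaDensity u p)), himg]
  rw [e]
  calc _ ≤ ∫⁻ q in Z, ENNReal.ofReal (1 + m ^ 2) * ENNReal.ofReal
        (areaDensity u (grimShear c x₀ q) / (1 + (u (grimShear c x₀ q) - z) ^ 2)) := by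
        refine setLIntegral_mono' hZc.measurableSet fun q hq => ?_
        rw [← ENNReal.ofReal_mul (by positivity)]
        refine ENNReal.ofReal_le_ofReal ?_
        rw [mul_div_assoc', le_div_iff₀ (by positivity), mul_comm]
        refine mul_le_mul_of_nonneg_right ?_ (sqrt_nonneg _)
        have := sq_le_sq' (abs_le.1 (hz _ (hZm q hq))).1 (abs_le.1 (hz _ (hZm q hq))).2
        linarith
    _ = ENNReal.ofReal (1 + m ^ 2) * ENNReal.ofReal (∫ q in Z,
        areaDensity u (grimShear c x₀ q) / (1 + (u (grimShear c x₀ q) - z) ^ 2)) := by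
        rw [lintegral_const_mul' _ _ ENNReal.ofReal_ne_top, ofReal_integral_eq_lintegral_ofReal hInt]
        exact Filter.Eventually.of_forall fun q => div_nonneg (sqrt_nonneg _) (by positivity)
    _ ≤ _ := by
        rw [← ENNReal.ofReal_mul (by positivity)]
        refine ENNReal.ofReal_le_ofReal (mul_le_mul_of_nonneg_left ?_ (by positivity))
        linarith

end LocalArea

section GraphArea

variable {Ω E : Set (ℝ × ℝ)} {u : ℝ × ℝ → ℝ}

/-- The point over `p` of the graph of `u` with respect to the basis `(a, b, v)`. -/
def graphPoint (a b v : E3) (u : ℝ × ℝ → ℝ) (p : ℝ × ℝ) : E3 := p.1 • a + p.2 • b + u p • v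

lemma dist_graphPoint_le {a b v : E3} (ha : ‖a‖ = 1) (hb : ‖b‖ = 1) (hv : ‖v‖ = 1) (p q : ℝ × ℝ) :
    dist (graphPoint a b v u p) (graphPoint a b v u q) ≤ 2 * dist p q + |u p - u q| := by
  have e : graphPoint a b v u p - graphPoint a b v u q
      = (p.1 - q.1) • a + (p.2 - q.2) • b + (u p - u q) • v := by
    simp only [graphPoint, sub_smul]; abel
  have h1 : |p.1 - q.1| ≤ dist p q := le_max_left (dist p.1 q.1) (dist p.2 q.2)
  have h2 : |p.2 - q.2| ≤ dist p q := le_max_right (dist p.1 q.1) (dist p.2 q.2)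
  rw [dist_eq_norm, e]
  refine (norm_add₃_le).trans ?_
  simp only [norm_smul, ha, hb, hv, mul_one, Real.norm_eq_abs]
  linarith

/-- Near any point one of the three coordinate projections of the graph is bi-Lipschitz with a
universal constant, and its Jacobian is controlled by the area density. -/
lemma exists_good_projection (hΩ : IsOpen Ω) (hu : ContDiffOn ℝ (⊤ : ℕ∞) u Ω) {p₀ : ℝ × ℝ}
    (hp₀ : p₀ ∈ Ω) :
    ∃ N : Set (ℝ × ℝ), IsOpen N ∧ p₀ ∈ N ∧ ∃ (P : ℝ × ℝ → ℝ × ℝ)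
      (P' : ℝ × ℝ → (ℝ × ℝ →L[ℝ] ℝ × ℝ)),
      (∀ p ∈ Ω, HasFDerivAt P (P' p) p) ∧ (∀ p, |(P' p).det| ≤ areaDensity u p) ∧
      ∀ p ∈ N, ∀ q ∈ N, dist p q ≤ 5 * dist (P p) (P q) ∧ |u p - u q| ≤ 5 * dist (P p) (P q) := by
  have hstrict := (hu.contDiffAt (hΩ.mem_nhds hp₀)).hasStrictFDerivAt (by simp)
  obtain ⟨N₀, hN₀, happ⟩ := hstrict.approximates_deriv_on_nhds (c := 1 / 2) (Or.inr (by norm_num))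
  obtain ⟨N, hNN, hNo, hpN⟩ := _root_.mem_nhds_iff.1 hN₀
  have key : ∀ p ∈ N, ∀ q ∈ N, |u p - u q - ((p.1 - q.1) * pds u p₀ + (p.2 - q.2) * pdt u p₀)|
      ≤ 1 / 2 * max |p.1 - q.1| |p.2 - q.2| := by
    intro p hp q hq
    have := happ p (hNN hp) q (hNN hq)
    rw [fderiv_apply_eq_partials] at this
    simpa [Prod.norm_def] using this
  have hd : ∀ p ∈ Ω, HasFDerivAt u (fderiv ℝ u p) p := fun p hp =>
    (differentiableAt_of_smooth hΩ hu hp).hasFDerivAt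
  refine ⟨N, hNo, hpN, ?_⟩
  set α := pds u p₀
  set β := pdt u p₀
  by_cases h1 : |α| ≤ 1 ∧ |β| ≤ 1
  · refine ⟨id, fun _ => ContinuousLinearMap.id ℝ _, fun p _ => hasFDerivAt_id p, fun p => ?_,
      fun p hp q hq => ?_⟩
    · simpa [det_prod_clm] using one_le_areaDensity u p
    · have h2 := key p hp q hq
      have h3 : dist p q = max |p.1 - q.1| |p.2 - q.2| := rfl
      rw [id, id, h3]
      set m := max |p.1 - q.1| |p.2 - q.2|
      have m1 : |p.1 - q.1| ≤ m := le_max_left _ _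
      have m2 : |p.2 - q.2| ≤ m := le_max_right _ _
      have m0 : 0 ≤ m := (abs_nonneg _).trans m1
      refine ⟨by linarith, ?_⟩
      have k1 : |(p.1 - q.1) * α| ≤ m := by
        rw [abs_mul]; nlinarith [abs_nonneg (p.1 - q.1), abs_nonneg α]
      have k2 : |(p.2 - q.2) * β| ≤ m := by
        rw [abs_mul]; nlinarith [abs_nonneg (p.2 - q.2), abs_nonneg β]
      rw [abs_le] at *
      constructor <;> linarith [h2.1, h2.2, k1.1, k1.2, k2.1, k2.2]
  · have aux : ∀ {α β x y z : ℝ}, |α| ≤ |β| → 1 ≤ |β| →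
        |z - (x * α + y * β)| ≤ 1 / 2 * max |x| |y| →
        max |x| |y| ≤ 5 * max |x| |z| ∧ |z| ≤ 5 * max |x| |z| := by
      intro α β x y z hαβ hβ hz
      set d := max |x| |z|
      have d1 : |x| ≤ d := le_max_left _ _
      have d2 : |z| ≤ d := le_max_right _ _
      have d0 : 0 ≤ d := (abs_nonneg _).trans d1
      refine ⟨max_le (by linarith) ?_, by linarith⟩
      have k1 : |x * α| ≤ d * |β| := by
        rw [abs_mul]; exact mul_le_mul d1 hαβ (abs_nonneg _) d0
      have k2 : max |x| |y| ≤ d + |y| :=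
        max_le (by linarith [abs_nonneg y]) (by linarith)
      have k3 : |y| * |β| ≤ |z| + |x * α| + 1 / 2 * (d + |y|) := by
        rw [← abs_mul]
        have : y * β = z - x * α - (z - (x * α + y * β)) := by ring
        rw [this]
        have t1 := abs_sub (z - x * α) (z - (x * α + y * β))
        have t2 := abs_sub z (x * α)
        linarith
      by_contra! hcon
      nlinarith [abs_nonneg y]
    by_cases h2 : |α| ≤ |β|
    · have hβ : 1 ≤ |β| := by
        by_contra! hcon
        exact h1 ⟨by linarith, hcon.le⟩
      refine ⟨fun p => (p.1, u p), fun p => (ContinuousLinearMap.fst ℝ ℝ ℝ).prod (fderiv ℝ u p),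
        fun p hp => hasFDerivAt_fst.prodMk (hd p hp), fun p => ?_, fun p hp q hq => ?_⟩
      · simpa [det_prod_clm, pds, pdt] using abs_pdt_le_areaDensity u p
      · exact aux h2 hβ (key p hp q hq)
    · have hα : 1 ≤ |α| := by
        by_contra! hcon
        exact h1 ⟨hcon.le, by linarith⟩
      refine ⟨fun p => (p.2, u p), fun p => (ContinuousLinearMap.snd ℝ ℝ ℝ).prod (fderiv ℝ u p),
        fun p hp => hasFDerivAt_snd.prodMk (hd p hp), fun p => ?_, fun p hp q hq => ?_⟩
      · simpa [det_prod_clm, pds, pdt] using abs_pds_le_areaDensity u p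
      · have h3 := key p hp q hq
        rw [max_comm, add_comm ((p.1 - q.1) * α)] at h3
        have := aux (not_le.1 h2).le hα h3
        rw [max_comm] at this
        exact this

lemma hausdorffMeasure_graph_le_of_projection {a b v : E3} (ha : ‖a‖ = 1) (hb : ‖b‖ = 1)
    (hv : ‖v‖ = 1) {A : Set (ℝ × ℝ)} (hA : MeasurableSet A) {P : ℝ × ℝ → ℝ × ℝ}
    {P' : ℝ × ℝ → (ℝ × ℝ →L[ℝ] ℝ × ℝ)} (hP : ∀ p ∈ A, HasFDerivAt P (P' p) p)
    (hdet : ∀ p, |(P' p).det| ≤ areaDensity u p)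
    (hdist : ∀ p ∈ A, ∀ q ∈ A, dist p q ≤ 5 * dist (P p) (P q) ∧
      |u p - u q| ≤ 5 * dist (P p) (P q)) :
    μH[2] (graphPoint a b v u '' A) ≤ 225 * ∫⁻ p in A, ENNReal.ofReal (areaDensity u p) := by
  have hinj : Set.InjOn P A := fun p hp q hq h => by
    have := (hdist p hp q hq).1
    rw [h, dist_self, mul_zero] at this
    exact dist_le_zero.1 this
  set g := graphPoint a b v u ∘ Function.invFunOn P A with hg
  have hgP : ∀ p ∈ A, g (P p) = graphPoint a b v u p := fun p hp =>
    congrArg (graphPoint a b v u) (hinj.leftInvOn_invFunOn hp)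
  have himg : graphPoint a b v u '' A = g '' (P '' A) := by
    rw [Set.image_image]
    exact (Set.image_congr hgP).symm
  have hlip : LipschitzOnWith 15 g (P '' A) := by
    refine LipschitzOnWith.of_dist_le_mul ?_
    rintro _ ⟨p, hp, rfl⟩ _ ⟨q, hq, rfl⟩
    rw [hgP p hp, hgP q hq]
    have h1 := dist_graphPoint_le (u := u) ha hb hv p q
    have h2 := hdist p hp q hq
    have h3 : ((15 : ℝ≥0) : ℝ) = 15 := rfl
    rw [h3]
    linarith [h2.1, h2.2]
  rw [himg]
  calc _ ≤ ((15 : ℝ≥0) : ℝ≥0∞) ^ (2 : ℝ) * μH[2] (P '' A) :=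
        hlip.hausdorffMeasure_image_le (by norm_num)
    _ = 225 * ∫⁻ p in A, ENNReal.ofReal |(P' p).det| := by
        rw [hausdorffMeasure_prod_real, ← lintegral_abs_det_fderiv_eq_addHaar_image volume hA
          (fun p hp => (hP p hp).hasFDerivWithinAt) hinj, ENNReal.rpow_two]
        norm_num
    _ ≤ _ := by
        gcongr with p
        exact hdet p

/-- The Hausdorff area of a graph is controlled by the integral of the area density. -/
lemma hausdorffMeasure_graph_le {a b v : E3} (ha : ‖a‖ = 1) (hb : ‖b‖ = 1) (hv : ‖v‖ = 1)
    (hΩ : IsOpen Ω) (hu : ContDiffOn ℝ (⊤ : ℕ∞) u Ω) (hE : MeasurableSet E) (hEΩ : E ⊆ Ω) :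
    μH[2] (graphPoint a b v u '' E) ≤ 225 * ∫⁻ p in E, ENNReal.ofReal (areaDensity u p) := by
  rcases E.eq_empty_or_nonempty with rfl | hne
  · simp
  choose! N hNo hpN P P' hP hdet hdist using
    fun p (hp : p ∈ Ω) => exists_good_projection hΩ hu hp
  obtain ⟨t, htE, htc, hcov⟩ := TopologicalSpace.countable_cover_nhdsWithin
    (fun p (hp : p ∈ E) => mem_nhdsWithin_of_mem_nhds
      ((hNo p (hEΩ hp)).mem_nhds (hpN p (hEΩ hp))))
  have htne : t.Nonempty := by
    obtain ⟨x, hx⟩ := hne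
    obtain ⟨y, hy, -⟩ := Set.mem_iUnion₂.1 (hcov hx)
    exact ⟨y, hy⟩
  obtain ⟨x, rfl⟩ := htc.exists_eq_range htne
  have hx : ∀ n, x n ∈ Ω := fun n => hEΩ (htE ⟨n, rfl⟩)
  set A : ℕ → Set (ℝ × ℝ) := fun n => E ∩ disjointed (fun n => N (x n)) n with hAdef
  have hAm : ∀ n, MeasurableSet (A n) := fun n =>
    hE.inter (MeasurableSet.disjointed (fun n => (hNo _ (hx n)).measurableSet) n)
  have hAN : ∀ n, A n ⊆ N (x n) := fun n =>
    Set.inter_subset_right.trans (disjointed_subset _ n)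
  have hAE : E = ⋃ n, A n := by
    rw [hAdef, ← Set.inter_iUnion, iUnion_disjointed]
    rw [Set.biUnion_range] at hcov
    exact (Set.inter_eq_left.2 hcov).symm
  have hAd : Pairwise (Function.onFun Disjoint A) := fun i j hij =>
    (disjoint_disjointed (fun n => N (x n)) hij).mono Set.inter_subset_right
      Set.inter_subset_right
  calc _ = μH[2] (⋃ n, graphPoint a b v u '' A n) := by rw [← Set.image_iUnion, ← hAE]
    _ ≤ ∑' n, μH[2] (graphPoint a b v u '' A n) := measure_iUnion_le _
    _ ≤ ∑' n, 225 * ∫⁻ p in A n, ENNReal.ofReal (areaDensity u p) :=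
        ENNReal.tsum_le_tsum fun n => hausdorffMeasure_graph_le_of_projection ha hb hv (hAm n)
          (fun p hp => hP _ (hx n) p (hEΩ hp.1)) (hdet _ (hx n))
          (fun p hp q hq => hdist _ (hx n) p (hAN n hp) q (hAN n hq))
    _ = _ := by
        rw [ENNReal.tsum_mul_left, ← lintegral_iUnion hAm hAd, ← hAE]

end GraphArea

section Rotation

variable {Ω : Set (ℝ × ℝ)} {u f : ℝ × ℝ → ℝ} {p : ℝ × ℝ} {C S : ℝ}

/-- The linear map of the plane with matrix `(C, -S; S, C)`. -/
def planeRotation (C S : ℝ) : ℝ × ℝ →L[ℝ] ℝ × ℝ :=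
  (C • ContinuousLinearMap.fst ℝ ℝ ℝ - S • ContinuousLinearMap.snd ℝ ℝ ℝ).prod
    (S • ContinuousLinearMap.fst ℝ ℝ ℝ + C • ContinuousLinearMap.snd ℝ ℝ ℝ)

lemma planeRotation_apply (C S : ℝ) (p : ℝ × ℝ) :
    planeRotation C S p = (C * p.1 - S * p.2, S * p.1 + C * p.2) := rfl

lemma planeRotation_neg_planeRotation (h : C ^ 2 + S ^ 2 = 1) (p : ℝ × ℝ) :
    planeRotation C (-S) (planeRotation C S p) = p := by
  simp only [planeRotation_apply]
  ext
  · linear_combination p.1 * h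
  · linear_combination p.2 * h

lemma planeRotation_planeRotation_neg (h : C ^ 2 + S ^ 2 = 1) (p : ℝ × ℝ) :
    planeRotation C S (planeRotation C (-S) p) = p := by
  simpa using planeRotation_neg_planeRotation (C := C) (S := -S) (by simpa using h) p

lemma pds_comp_planeRotation (hf : DifferentiableAt ℝ f (planeRotation C S p)) :
    pds (fun q => f (planeRotation C S q)) p
      = C * pds f (planeRotation C S p) + S * pdt f (planeRotation C S p) := by
  have := (hf.hasFDerivAt.comp p (planeRotation C S).hasFDerivAt).fderiv
  change fderiv ℝ (fun q => f (planeRotation C S q)) p = _ at this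
  rw [pds, this, ContinuousLinearMap.comp_apply, fderiv_apply_eq_partials]
  simp [planeRotation_apply]

lemma pdt_comp_planeRotation (hf : DifferentiableAt ℝ f (planeRotation C S p)) :
    pdt (fun q => f (planeRotation C S q)) p
      = -S * pds f (planeRotation C S p) + C * pdt f (planeRotation C S p) := by
  have := (hf.hasFDerivAt.comp p (planeRotation C S).hasFDerivAt).fderiv
  change fderiv ℝ (fun q => f (planeRotation C S q)) p = _ at this
  rw [pdt, this, ContinuousLinearMap.comp_apply, fderiv_apply_eq_partials]
  simp [planeRotation_apply]

lemma pds_linear_combination {f g : ℝ × ℝ → ℝ} (hf : DifferentiableAt ℝ f p)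
    (hg : DifferentiableAt ℝ g p) (m n : ℝ) :
    pds (fun q => m * f q + n * g q) p = m * pds f p + n * pds g p := by
  rw [pds, fderiv_fun_add (hf.const_mul m) (hg.const_mul n), fderiv_const_mul hf,
    fderiv_const_mul hg]
  rfl

lemma pdt_linear_combination {f g : ℝ × ℝ → ℝ} (hf : DifferentiableAt ℝ f p)
    (hg : DifferentiableAt ℝ g p) (m n : ℝ) :
    pdt (fun q => m * f q + n * g q) p = m * pdt f p + n * pdt g p := by
  rw [pdt, fderiv_fun_add (hf.const_mul m) (hg.const_mul n), fderiv_const_mul hf,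
    fderiv_const_mul hg]
  rfl

lemma norm_rotate_eq_one {x y : E3} (hx : ‖x‖ = 1) (hy : ‖y‖ = 1) (hxy : ⟪x, y⟫ = 0)
    (h : C ^ 2 + S ^ 2 = 1) : ‖C • x + S • y‖ = 1 := by
  have : ‖C • x + S • y‖ ^ 2 = 1 := by
    rw [norm_add_sq_real, norm_smul, norm_smul, hx, hy, real_inner_smul_left,
      real_inner_smul_right, hxy]
    simpa using h
  exact (pow_eq_one_iff_of_nonneg (norm_nonneg _) two_ne_zero).1 this

/-- A translating graph remains one when the basis of the horizontal plane is rotated. -/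
lemma IsTranslatingGraph.rotate {a b v : E3} {T : Set E3}
    (h : IsTranslatingGraph a b v Ω u T) (hr : C ^ 2 + S ^ 2 = 1) :
    IsTranslatingGraph (C • a + S • b) (-S • a + C • b) v (planeRotation C S ⁻¹' Ω)
      (fun q => u (planeRotation C S q)) T where
  norm_a := norm_rotate_eq_one h.norm_a h.norm_b h.inner_ab hr
  norm_b := norm_rotate_eq_one h.norm_a h.norm_b h.inner_ab (by linarith [neg_sq S])
  norm_v := h.norm_v
  inner_ab := by
    simp only [inner_add_left, inner_add_right, real_inner_smul_left, real_inner_smul_right,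
      real_inner_comm a b, real_inner_self_eq_norm_sq, h.norm_a, h.norm_b, h.inner_ab]
    ring
  inner_av := by
    simp [inner_add_left, real_inner_smul_left, h.inner_av, h.inner_bv]
  inner_bv := by
    simp [inner_add_left, real_inner_smul_left, h.inner_av, h.inner_bv]
  isOpen_dom := h.isOpen_dom.preimage (planeRotation C S).continuous
  isConnected_dom := by
    have : planeRotation C S ⁻¹' Ω = planeRotation C (-S) '' Ω :=
      (congrFun (Set.image_eq_preimage_of_inverse (planeRotation_planeRotation_neg hr)
        (planeRotation_neg_planeRotation hr)) Ω).symm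
    rw [this]
    exact h.isConnected_dom.image _ (planeRotation C (-S)).continuous.continuousOn
  smooth := h.smooth.comp (planeRotation C S).contDiff.contDiffOn fun _ hq => hq
  pde := by
    intro p hp
    have hO := h.isOpen_dom.preimage (planeRotation C S).continuous
    have hd : ∀ {g : ℝ × ℝ → ℝ}, ContDiffOn ℝ (⊤ : ℕ∞) g Ω → ∀ q ∈ planeRotation C S ⁻¹' Ω,
        DifferentiableAt ℝ g (planeRotation C S q) := fun hg q hq =>
      differentiableAt_of_smooth h.isOpen_dom hg hq
    have hus := contDiffOn_pds h.isOpen_dom h.smooth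
    have hut := contDiffOn_pdt h.isOpen_dom h.smooth
    have e1 : (fun q => pds (fun q => u (planeRotation C S q)) q) =ᶠ[nhds p]
        fun q => C * pds u (planeRotation C S q) + S * pdt u (planeRotation C S q) := by
      filter_upwards [hO.mem_nhds hp] with q hq
      exact pds_comp_planeRotation (hd h.smooth q hq)
    have e2 : (fun q => pdt (fun q => u (planeRotation C S q)) q) =ᶠ[nhds p]
        fun q => -S * pds u (planeRotation C S q) + C * pdt u (planeRotation C S q) := by
      filter_upwards [hO.mem_nhds hp] with q hq
      exact pdt_comp_planeRotation (hd h.smooth q hq)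
    have d1 : DifferentiableAt ℝ (fun q => pds u (planeRotation C S q)) p :=
      (hd hus p hp).comp p (planeRotation C S).differentiableAt
    have d2 : DifferentiableAt ℝ (fun q => pdt u (planeRotation C S q)) p :=
      (hd hut p hp).comp p (planeRotation C S).differentiableAt
    have hA : pds (fun q => pds (fun q => u (planeRotation C S q)) q) p = _ :=
      (congrArg (fun L : ℝ × ℝ →L[ℝ] ℝ => L (1, 0)) e1.fderiv_eq).trans
        (pds_linear_combination d1 d2 C S)
    have hB : pdt (fun q => pds (fun q => u (planeRotation C S q)) q) p = _ :=
      (congrArg (fun L : ℝ × ℝ →L[ℝ] ℝ => L (0, 1)) e1.fderiv_eq).trans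
        (pdt_linear_combination d1 d2 C S)
    have hD : pdt (fun q => pdt (fun q => u (planeRotation C S q)) q) p = _ :=
      (congrArg (fun L : ℝ × ℝ →L[ℝ] ℝ => L (0, 1)) e2.fderiv_eq).trans
        (pdt_linear_combination d1 d2 (-S) C)
    rw [hA, hB, hD, e1.eq_of_nhds, e2.eq_of_nhds, pds_comp_planeRotation (hd hus p hp),
      pds_comp_planeRotation (hd hut p hp), pdt_comp_planeRotation (hd hus p hp),
      pdt_comp_planeRotation (hd hut p hp), pds_pdt_comm h.isOpen_dom h.smooth hp]
    have hpde := h.pde _ hp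
    simp only [inner_add_right, real_inner_smul_right]
    change (1 + pdt u (planeRotation C S p) ^ 2) * pds (pds u) (planeRotation C S p)
      - 2 * pds u (planeRotation C S p) * pdt u (planeRotation C S p)
        * pdt (pds u) (planeRotation C S p)
      + (1 + pds u (planeRotation C S p) ^ 2) * pdt (pdt u) (planeRotation C S p) = _ at hpde
    set x := pds u (planeRotation C S p)
    set y := pdt u (planeRotation C S p)
    set A := pds (pds u) (planeRotation C S p)
    set B := pdt (pds u) (planeRotation C S p)
    set D := pdt (pdt u) (planeRotation C S p)
    have l : (1 + (-S * x + C * y) ^ 2) * (C * (C * A + S * B) + S * (C * B + S * D))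
        - 2 * (C * x + S * y) * (-S * x + C * y)
          * (C * (-S * A + C * B) + S * (-S * B + C * D))
        + (1 + (C * x + S * y) ^ 2) * (-S * (-S * A + C * B) + C * (-S * B + C * D))
        = (C ^ 2 + S ^ 2) * (A + D)
          + (C ^ 2 + S ^ 2) ^ 2 * (y ^ 2 * A - 2 * x * y * B + x ^ 2 * D) := by ring
    have r : (1 + (C * x + S * y) ^ 2 + (-S * x + C * y) ^ 2) * (⟪e3, v⟫
          - (C * x + S * y) * (C * ⟪e3, a⟫ + S * ⟪e3, b⟫)
          - (-S * x + C * y) * (-S * ⟪e3, a⟫ + C * ⟪e3, b⟫))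
        = (1 + (C ^ 2 + S ^ 2) * (x ^ 2 + y ^ 2)) * (⟪e3, v⟫
          - (C ^ 2 + S ^ 2) * (x * ⟪e3, a⟫ + y * ⟪e3, b⟫)) := by ring
    rw [l, r, hr]
    linear_combination hpde
  graph_eq := by
    have e : ∀ p : ℝ × ℝ, p.1 • (C • a + S • b) + p.2 • (-S • a + C • b)
        = (planeRotation C S p).1 • a + (planeRotation C S p).2 • b := fun p => by
      simp only [planeRotation_apply]; module
    rw [h.graph_eq]
    ext q
    simp only [Set.mem_ofPred_eq, e]
    constructor
    · rintro ⟨p, hp, rfl⟩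
      exact ⟨planeRotation C (-S) p, by
        rwa [Set.mem_preimage, planeRotation_planeRotation_neg hr], by
        rw [planeRotation_planeRotation_neg hr]⟩
    · rintro ⟨p, hp, rfl⟩
      exact ⟨_, hp, rfl⟩

/-- Any translating graph can be written in a basis whose first vector is horizontal. -/
lemma IsTranslatingGraph.exists_horizontal {a b v : E3} {T : Set E3}
    (h : IsTranslatingGraph a b v Ω u T) :
    ∃ a' b' Ω' u', IsTranslatingGraph a' b' v Ω' u' T ∧ ⟪e3, a'⟫ = 0 := by
  obtain ⟨C, S, hr, h0⟩ : ∃ C S : ℝ, C ^ 2 + S ^ 2 = 1 ∧ C * ⟪e3, a⟫ + S * ⟪e3, b⟫ = 0 := by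
    by_cases h0 : ⟪e3, a⟫ ^ 2 + ⟪e3, b⟫ ^ 2 = 0
    · refine ⟨1, 0, by norm_num, ?_⟩
      have : ⟪e3, a⟫ = 0 := pow_eq_zero_iff two_ne_zero |>.1
        (by nlinarith [sq_nonneg ⟪e3, a⟫, sq_nonneg ⟪e3, b⟫])
      simp [this]
    · have hpos : 0 < ⟪e3, a⟫ ^ 2 + ⟪e3, b⟫ ^ 2 := lt_of_le_of_ne (by positivity) (Ne.symm h0)
      have hs := sqrt_pos.2 hpos
      have hsq := sq_sqrt hpos.le
      refine ⟨⟪e3, b⟫ / √(⟪e3, a⟫ ^ 2 + ⟪e3, b⟫ ^ 2), -⟪e3, a⟫ / √(⟪e3, a⟫ ^ 2 + ⟪e3, b⟫ ^ 2),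
        ?_, by ring⟩
      rw [div_pow, div_pow, hsq, ← add_div, div_eq_one_iff_eq h0]
      ring
  exact ⟨_, _, _, _, h.rotate hr, by rw [inner_add_right, real_inner_smul_right,
    real_inner_smul_right, h0]⟩

end Rotation

section Assembly

variable {Ω : Set (ℝ × ℝ)} {u : ℝ × ℝ → ℝ} {a b v : E3} {T : Set E3}

lemma norm_e3 : ‖e3‖ = 1 := by simp [e3]

lemma IsTranslatingGraph.inner_point (h : IsTranslatingGraph a b v Ω u T) (x y t : ℝ) :
    ⟪x • a + y • b + t • v, a⟫ = x ∧ ⟪x • a + y • b + t • v, b⟫ = y ∧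
      ⟪x • a + y • b + t • v, v⟫ = t := by
  simp only [inner_add_left, real_inner_smul_left, real_inner_self_eq_norm_sq, h.norm_a, h.norm_b,
    h.norm_v, h.inner_ab, h.inner_av, h.inner_bv, real_inner_comm a b, real_inner_comm a v,
    real_inner_comm b v]
  norm_num

lemma IsTranslatingGraph.planarTranslator (h : IsTranslatingGraph a b v Ω u T)
    (hcl : IsClosed T) (ha : ⟪e3, a⟫ = 0) : PlanarTranslator ⟪e3, b⟫ ⟪e3, v⟫ Ω u where
  abs_c := by simpa [norm_e3, h.norm_b] using abs_real_inner_le_norm e3 b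
  abs_s := by simpa [norm_e3, h.norm_v] using abs_real_inner_le_norm e3 v
  isOpen := h.isOpen_dom
  isPreconnected := h.isConnected_dom.isPreconnected
  smooth := h.smooth
  pde p hp := by rw [h.pde p hp, ha]; ring
  closed := by
    have hc : Continuous fun x : (ℝ × ℝ) × ℝ => x.1.1 • a + x.1.2 • b + x.2 • v := by fun_prop
    convert hcl.preimage hc using 1
    ext x
    rw [Set.mem_preimage, h.graph_eq]
    constructor
    · rintro ⟨hx, hx'⟩
      exact ⟨x.1, hx, by rw [hx']⟩
    · rintro ⟨p, hp, he⟩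
      have h1 := h.inner_point x.1.1 x.1.2 x.2
      have h2 := h.inner_point p.1 p.2 (u p)
      rw [he] at h1
      have e1 : x.1 = p := Prod.ext (h1.1.symm.trans h2.1) (h1.2.1.symm.trans h2.2.1)
      exact ⟨e1 ▸ hp, e1 ▸ h1.2.2.symm.trans h2.2.2⟩

lemma PlanarTranslator.isCompact_inter_box {c s : ℝ} (h : PlanarTranslator c s Ω u)
    {K : Set (ℝ × ℝ)} (hK : IsCompact K) (z m : ℝ) :
    IsCompact {p | p ∈ Ω ∧ p ∈ K ∧ |u p - z| ≤ m} := by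
  have hc : IsCompact (K ×ˢ closedBall z m) := hK.prod (isCompact_closedBall z m)
  convert (hc.inter_right h.closed).image continuous_fst using 1
  ext p
  constructor
  · rintro ⟨h1, h2, h3⟩
    exact ⟨(p, u p), ⟨⟨h2, h3⟩, h1, rfl⟩, rfl⟩
  · rintro ⟨⟨p, t⟩, ⟨⟨h2, h3⟩, h1, rfl : t = u p⟩, rfl⟩
    exact ⟨h1, h2, h3⟩

/-- Area bound for the part of a graph in a box adapted to the basis of the graph. -/
lemma PlanarTranslator.hausdorffMeasure_box_le {c s : ℝ} (h : PlanarTranslator c s Ω u)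
    (ha : ‖a‖ = 1) (hb : ‖b‖ = 1) (hv : ‖v‖ = 1) {w : ℝ} (hw : 0 < w) (x y z : ℝ) :
    μH[2] (graphPoint a b v u ''
        {p | p ∈ Ω ∧ |p.1 - x| ≤ w ∧ |p.2 - y| ≤ w ∧ |u p - z| ≤ w})
      ≤ ENNReal.ofReal ((⌊2 * w⌋₊ + 1) * (225 * ((1 + w ^ 2) * (17 * (3 + 2 * w))))) := by
  set X : ℕ → ℝ := fun k => x - w + k + 1 / 2 with hX
  set E : ℕ → Set (ℝ × ℝ) := fun k => {p | p ∈ Ω ∧ p ∈ Set.Icc (X k - 1 / 2) (X k + 1 / 2)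
    ×ˢ Set.Icc (y - w) (y - w + 2 * w) ∧ |u p - z| ≤ w} with hE
  have hEc : ∀ k, IsCompact (E k) := fun k =>
    h.isCompact_inter_box (isCompact_Icc.prod isCompact_Icc) z w
  have hEm : ∀ k, μH[2] (graphPoint a b v u '' E k)
      ≤ ENNReal.ofReal (225 * ((1 + w ^ 2) * (17 * (3 + 2 * w)))) := by
    intro k
    refine (hausdorffMeasure_graph_le ha hb hv h.isOpen h.smooth (hEc k).measurableSet
      fun p hp => hp.1).trans ?_
    have := h.lintegral_areaDensity_le (hEc k) (fun p hp => hp.1) (by linarith)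
      (fun p hp => hp.2.1) (fun p hp => hp.2.2)
    rw [ENNReal.ofReal_mul (by norm_num)]
    gcongr
    norm_num
  have hcov : {p | p ∈ Ω ∧ |p.1 - x| ≤ w ∧ |p.2 - y| ≤ w ∧ |u p - z| ≤ w}
      ⊆ ⋃ k ∈ Finset.range (⌊2 * w⌋₊ + 1), E k := by
    rintro p ⟨h1, h2, h3, h4⟩
    rw [abs_le] at h2 h3
    have h5 : 0 ≤ p.1 - (x - w) := by linarith
    have h6 := Nat.floor_le h5
    have h7 := Nat.lt_floor_add_one (p.1 - (x - w))
    refine Set.mem_iUnion₂.2 ⟨⌊p.1 - (x - w)⌋₊, Finset.mem_range.2 (Nat.lt_succ_of_le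
      (Nat.floor_mono (by linarith))), h1, ⟨⟨?_, ?_⟩, ?_, ?_⟩, h4⟩
    · simp only [hX]; linarith
    · simp only [hX]; linarith
    · linarith
    · linarith
  calc _ ≤ μH[2] (⋃ k ∈ Finset.range (⌊2 * w⌋₊ + 1), graphPoint a b v u '' E k) := by
        rw [← Set.image_iUnion₂]
        exact measure_mono (Set.image_mono hcov)
    _ ≤ ∑ k ∈ Finset.range (⌊2 * w⌋₊ + 1), μH[2] (graphPoint a b v u '' E k) :=
        measure_biUnion_finset_le _ _
    _ ≤ ∑ k ∈ Finset.range (⌊2 * w⌋₊ + 1),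
        ENNReal.ofReal (225 * ((1 + w ^ 2) * (17 * (3 + 2 * w)))) :=
        Finset.sum_le_sum fun k _ => hEm k
    _ = _ := by
        rw [Finset.sum_const, Finset.card_range, nsmul_eq_mul, ← Nat.cast_add_one,
          ENNReal.ofReal_mul (Nat.cast_nonneg _), ENNReal.ofReal_natCast]

lemma norm_sub_center_le {w : ℝ} (hw : 0 < w) {c : Fin 3 → ℝ} {q : E3}
    (hq : ∀ i, c i ≤ q i ∧ q i ≤ c i + w) :
    ‖q - WithLp.toLp 2 (fun i => c i + w / 2)‖ ≤ w := by
  rw [EuclideanSpace.norm_eq]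
  refine sqrt_le_iff.2 ⟨hw.le, ?_⟩
  have h : ∀ i, (q i - (c i + w / 2)) ^ 2 ≤ (w / 2) ^ 2 := fun i =>
    sq_le_sq' (by linarith [(hq i).1]) (by linarith [(hq i).2])
  simp only [Fin.sum_univ_three, Real.norm_eq_abs, sq_abs, PiLp.sub_apply]
  nlinarith [h 0, h 1, h 2, sq_nonneg w]

lemma IsTranslatingGraph.hausdorffMeasure_cube_le {w : ℝ} (hw : 0 < w)
    (h : IsTranslatingGraph a b v Ω u T) (hcl : IsClosed T) (c : Fin 3 → ℝ) :
    μH[2] ({q : E3 | ∀ i, c i ≤ q i ∧ q i ≤ c i + w} ∩ T)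
      ≤ ENNReal.ofReal ((⌊2 * w⌋₊ + 1) * (225 * ((1 + w ^ 2) * (17 * (3 + 2 * w))))) := by
  obtain ⟨a, b, Ω, u, h, ha⟩ := h.exists_horizontal
  set m : E3 := WithLp.toLp 2 (fun i => c i + w / 2)
  refine (measure_mono ?_).trans ((h.planarTranslator hcl ha).hausdorffMeasure_box_le h.norm_a
    h.norm_b h.norm_v hw ⟪m, a⟫ ⟪m, b⟫ ⟪m, v⟫)
  rintro q ⟨hq, hqS⟩
  rw [h.graph_eq] at hqS
  obtain ⟨p, hp, rfl⟩ := hqS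
  have hn := norm_sub_center_le hw hq
  have key : ∀ e : E3, ‖e‖ = 1 →
      |⟪p.1 • a + p.2 • b + u p • v, e⟫ - ⟪m, e⟫| ≤ w := fun e he => by
    rw [← inner_sub_left]
    exact (abs_real_inner_le_norm _ _).trans (by rw [he, mul_one]; exact hn)
  obtain ⟨i1, i2, i3⟩ := h.inner_point p.1 p.2 (u p)
  exact ⟨p, ⟨hp, i1 ▸ key a h.norm_a, i2 ▸ key b h.norm_b, i3 ▸ key v h.norm_v⟩, rfl⟩

end Assembly

/-- uniform area bound in cubes of side `w` for complete connected translating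
graphs contained in the slab `{|x| ≤ w}`, with a constant independent of the cube and the
graph. -/
theorem stmt2 (w : ℝ) (hw : 0 < w) :
    ∃ C : ℝ, 0 < C ∧
      ∀ (a b v : E3) (Ω : Set (ℝ × ℝ)) (u : ℝ × ℝ → ℝ) (S : Set E3),
        IsTranslatingGraph a b v Ω u S → IsClosed S → S ⊆ {q : E3 | |q 0| ≤ w} →
          ∀ c : Fin 3 → ℝ,
            μH[2] ({q : E3 | ∀ i, c i ≤ q i ∧ q i ≤ c i + w} ∩ S)
              ≤ ENNReal.ofReal C := by
  refine ⟨(⌊2 * w⌋₊ + 1) * (225 * ((1 + w ^ 2) * (17 * (3 + 2 * w)))), by positivity, ?_⟩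
  intro a b v Ω u S h hcl _ c
  exact h.hausdorffMeasure_cube_le hw hcl c
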